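/- arXiv:math/0703045 — 2 statements merged into one kernel-verified Lean document; each statement's English description precedes it below -/
import Mathlib

section
/- Assume T is dependent and G is abelian. If k(1)+2 < k(2) < ω and α < κ̄, then there are λ < κ̄ and sequences ā_ε ∈ ^α𝔠 for ε < λ such that for every ā ∈ ^α𝔠 satisfying A* ⊆ Rang(ā) we have ⋂{q^{k(1)}_{ā_ε}(𝔠) : ε < λ} ⊆ q^{k(2)}_{ā}(𝔠), i.e. ⋃_{ε<λ} q^{k(1)}_{ā_ε} ⊢ q^{k(2)}_{ā}. Moreover λ = 2^{2^{|α|+|T|+|A*|}} suffices, and λ and the sequences ā_ε can be chosen independently of k(1) and k(2). -/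
open FirstOrder Cardinal Set

universe u

namespace Paper886

section Basic

variable (L : FirstOrder.Language.{u, u}) (M : Type u) [L.Structure M]

/-- A first-order formula in `n` object variables together with a finite tuple of
parameters from `M`. -/
structure ParamFormula (n : ℕ) : Type u where
  m : ℕ
  toFormula : L.Formula (Fin n ⊕ Fin m)
  params : Fin m → M

variable {L M}

/-- Realization of a parametrized formula at a tuple. -/
def ParamFormula.Realize {n : ℕ} (f : ParamFormula L M n) (v : Fin n → M) : Prop :=
  f.toFormula.Realize (Sum.elim v f.params)

/-- The parameters of `f` all lie in `B`. -/
def ParamFormula.paramsIn {n : ℕ} (f : ParamFormula L M n) (B : Set M) : Prop :=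
  ∀ i, f.params i ∈ B

/-- The set of realizations of a partial 1-type. -/
def realizeSet (p : Set (ParamFormula L M 1)) : Set M :=
  {a | ∀ f ∈ p, f.Realize fun _ => a}

/-- The partial type `p` is over the parameter set `B`. -/
def IsTypeOver (p : Set (ParamFormula L M 1)) (B : Set M) : Prop :=
  ∀ f ∈ p, f.paramsIn B

variable (L) in
/-- Two tuples realize the same type over a set `A` of parameters. -/
def SameType {α : Type u} (A : Set M) (a b : α → M) : Prop :=
  ∀ (n mp : ℕ) (φ : L.Formula (Fin n ⊕ Fin mp)) (vs : Fin n → α) (ps : Fin mp → M),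
    (∀ i, ps i ∈ A) →
      (φ.Realize (Sum.elim (fun i => a (vs i)) ps) ↔ φ.Realize (Sum.elim (fun i => b (vs i)) ps))

variable (L M)

/-- `M` is `κ`-saturated: every finitely satisfiable 1-type over fewer than `κ`
parameters is realized in `M`. -/
def Saturated (κ : Cardinal.{u}) : Prop :=
  ∀ B : Set M, #B < κ → ∀ p : Set (ParamFormula L M 1), IsTypeOver p B →
    (∀ s : Set (ParamFormula L M 1), s ⊆ p → s.Finite → ∃ a : M, ∀ f ∈ s, f.Realize fun _ => a) →
    ∃ a : M, a ∈ realizeSet p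

/-- `Th(M)` is dependent (NIP): no formula has the independence property, where consistency
of a pattern is rendered as finite satisfiability in the (saturated) monster. -/
def IsDependent : Prop :=
  ∀ (nx np : ℕ) (φ : L.Formula (Fin nx ⊕ Fin np)) (a : ℕ → Fin np → M),
    ¬ ∀ (u : Set ℕ) (s : Finset ℕ), ∃ x : Fin nx → M,
        ∀ i ∈ s, (φ.Realize (Sum.elim x (a i)) ↔ i ∈ u)

variable {L M}

/-- The cardinality `|T|` of the (complete) theory of `M`. -/
noncomputable def theoryCard (L : FirstOrder.Language.{u, u}) : Cardinal.{u} :=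
  ℵ₀ ⊔ L.card

variable (L M)

/-- A type-definable group: a partial type `p*` over `A*` together with definitions
(over `A*`) of the group operations making `p*(𝔠)` a group. -/
structure DefGroup : Type u where
  AStar : Set M
  pStar : Set (ParamFormula L M 1)
  pStar_over : IsTypeOver pStar AStar
  mul : M → M → M
  inv : M → M
  one : M
  mul_definable : ∃ φ : ParamFormula L M 3, φ.paramsIn AStar ∧
    ∀ x y z : M, (φ.Realize ![x, y, z] ↔ mul x y = z)
  inv_definable : ∃ φ : ParamFormula L M 2, φ.paramsIn AStar ∧
    ∀ x y : M, (φ.Realize ![x, y] ↔ inv x = y)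
  one_definable : ∃ φ : ParamFormula L M 1, φ.paramsIn AStar ∧
    ∀ x : M, (φ.Realize ![x] ↔ x = one)
  one_mem' : one ∈ realizeSet pStar
  mul_mem' : ∀ x ∈ realizeSet pStar, ∀ y ∈ realizeSet pStar, mul x y ∈ realizeSet pStar
  inv_mem' : ∀ x ∈ realizeSet pStar, inv x ∈ realizeSet pStar
  mul_assoc' : ∀ x ∈ realizeSet pStar, ∀ y ∈ realizeSet pStar, ∀ z ∈ realizeSet pStar,
    mul (mul x y) z = mul x (mul y z)
  one_mul' : ∀ x ∈ realizeSet pStar, mul one x = x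
  mul_one' : ∀ x ∈ realizeSet pStar, mul x one = x
  inv_mul' : ∀ x ∈ realizeSet pStar, mul (inv x) x = one
  mul_inv' : ∀ x ∈ realizeSet pStar, mul x (inv x) = one

variable {L M}

namespace DefGroup

variable (D : DefGroup L M)

/-- The underlying set of the group `G = p*(𝔠)`. -/
def carrier : Set M := realizeSet D.pStar

/-- `G` is abelian. -/
def IsAbelian : Prop := ∀ x ∈ D.carrier, ∀ y ∈ D.carrier, D.mul x y = D.mul y x

/-- `H` is a subgroup of `G`. -/
def IsSubgroup (H : Set M) : Prop :=
  H ⊆ D.carrier ∧ D.one ∈ H ∧ (∀ x ∈ H, ∀ y ∈ H, D.mul x y ∈ H) ∧ ∀ x ∈ H, D.inv x ∈ H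

/-- `(G : H) ≤ c`: at most `c` left cosets of `H` cover `G`. -/
def indexLE (H : Set M) (c : Cardinal.{u}) : Prop :=
  ∃ S : Set M, S ⊆ D.carrier ∧ #S ≤ c ∧ ∀ g ∈ D.carrier, ∃ s ∈ S, D.mul (D.inv s) g ∈ H

/-- `(G : H) < c`: fewer than `c` left cosets of `H` cover `G`. -/
def indexLT (H : Set M) (c : Cardinal.{u}) : Prop :=
  ∃ S : Set M, S ⊆ D.carrier ∧ #S < c ∧ ∀ g ∈ D.carrier, ∃ s ∈ S, D.mul (D.inv s) g ∈ H

/-- The realization set of the partial type `q^n_Γ`. -/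
def qSet (Γ : Set (ParamFormula L M 1)) (n : ℕ) : Set M :=
  {c | ∃ d : Fin n → M × M,
    (∀ ℓ, (d ℓ).1 ∈ D.carrier ∧ (d ℓ).2 ∈ D.carrier) ∧
    (∀ ℓ, ∀ f ∈ Γ, (f.Realize fun _ => (d ℓ).1) ↔ (f.Realize fun _ => (d ℓ).2)) ∧
    c = (List.ofFn fun ℓ => D.mul (D.inv (d ℓ).1) (d ℓ).2).foldr D.mul D.one}

/-- The realization set of `q^n_{ā}`, i.e. `q^n_{Γ_ā}` where `Γ_ā` consists of all
formulas with parameters in the range of `ā`. -/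
def qTupleSet {α : Type u} (a : α → M) (n : ℕ) : Set M :=
  D.qSet {f : ParamFormula L M 1 | f.paramsIn (Set.range a)} n

end DefGroup

end Basic

variable {L : FirstOrder.Language.{u, u}} {M : Type u} [L.Structure M]

variable (L) in
/-- `X` is the union of fewer than `κ` realization sets of types over `B`. -/
def UnionTypeDefOver (X B : Set M) (κ : Cardinal.{u}) : Prop :=
  ∃ ι : Type u, #ι < κ ∧ ∃ P : ι → Set (ParamFormula L M 1),
    (∀ i, IsTypeOver (P i) B) ∧ X = ⋃ i, realizeSet (P i)

variable (L) in
/-- `X` is union-type-definable (with fewer than `κ` parameters altogether). -/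
def UnionTypeDefinable (X : Set M) (κ : Cardinal.{u}) : Prop :=
  ∃ B : Set M, #B < κ ∧ UnionTypeDefOver L X B κ

/-- `G_q = (p* ∪ q)(𝔠)`. -/
def Gq (D : DefGroup L M) (q : Set (ParamFormula L M 1)) : Set M :=
  realizeSet (D.pStar ∪ q)

/-- `R_B`: the family of 1-types `q` over `B` such that `G_q` is a subgroup of `G`
of index `< κ`. -/
def RB (D : DefGroup L M) (κ : Cardinal.{u}) (B : Set M) : Set (Set (ParamFormula L M 1)) :=
  {q | IsTypeOver q B ∧ D.IsSubgroup (Gq D q) ∧ D.indexLT (Gq D q) κ}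

/-- `q_B`, the union of all members of `R_B`. -/
def qB (D : DefGroup L M) (κ : Cardinal.{u}) (B : Set M) : Set (ParamFormula L M 1) :=
  ⋃₀ RB D κ B

/-- `G_B = q_B(𝔠) ∩ G`. -/
def GB (D : DefGroup L M) (κ : Cardinal.{u}) (B : Set M) : Set M :=
  realizeSet (qB D κ B) ∩ D.carrier

/-- The complete type of `a` over `A` (as the set of all param-formulas over `A`
satisfied by `a`). -/
def typeOf (A : Set M) (a : M) : Set (ParamFormula L M 1) :=
  {f | f.paramsIn A ∧ f.Realize fun _ => a}

/-- `φ(x̄, ȳ₀, …, ȳ_{k-1})` is `k`-independent: for every index set of size `< κ` there is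
an array of parameter tuples such that every pattern on `^k ι` is (finitely) satisfiable. -/
def FormulaKIndep (M : Type u) [L.Structure M] (κ : Cardinal.{u}) (k nx : ℕ) (ny : Fin k → ℕ)
    (φ : L.Formula (Fin nx ⊕ ((ℓ : Fin k) × Fin (ny ℓ)))) : Prop :=
  ∀ ι : Type u, #ι < κ →
    ∃ a : (ℓ : Fin k) → ι → Fin (ny ℓ) → M,
      ∀ (u : Set (Fin k → ι)) (s : Finset (Fin k → ι)),
        ∃ x : Fin nx → M,
          ∀ η ∈ s, ((φ.Realize (Sum.elim x fun p => a p.1 (η p.1) p.2)) ↔ η ∈ u)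

/-- `Th(M)` is `k`-independent. -/
def KIndependent (L : FirstOrder.Language.{u, u}) (M : Type u) [L.Structure M] (κ : Cardinal.{u})
    (k : ℕ) : Prop :=
  ∃ (nx : ℕ) (ny : Fin k → ℕ) (φ : L.Formula (Fin nx ⊕ ((ℓ : Fin k) × Fin (ny ℓ)))),
    FormulaKIndep M κ k nx ny φ

/-- `Th(M)` is `k`-dependent. -/
def KDependent (L : FirstOrder.Language.{u, u}) (M : Type u) [L.Structure M] (κ : Cardinal.{u})
    (k : ℕ) : Prop :=
  ¬ KIndependent L M κ k

section Combinatorics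

open Filter

variable {S K A : Type*}

/-- A limit value, along a nonprincipal ultrafilter, of a sequence with finitely many values. -/
theorem exists_ultralimit [Finite K] (f : ℕ → K) : ∃ k, ∀ᶠ i in hyperfilter ℕ, f i = k :=
  Ultrafilter.eventually_exists_iff.1 (Eventually.of_forall fun i => ⟨f i, rfl⟩)

/-- The state reached from `s` when the word `w` is read, the letters acting successively along
the indices `h k, h (k + 1), …`. -/
def runWord (step : A → ℕ → S → S) (h : ℕ → ℕ) : ℕ → S → List A → S
  | _, s, [] => s
  | k, s, a :: w => runWord step h (k + 1) (step a (h k) s) w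

theorem runWord_append (step : A → ℕ → S → S) (h : ℕ → ℕ) (w w' : List A) (k : ℕ) (s : S) :
    runWord step h k s (w ++ w') = runWord step h (k + w.length) (runWord step h k s w) w' := by
  induction w generalizing k s with
  | nil => simp [runWord]
  | cons a w ih => simp only [List.cons_append, runWord, ih, List.length_cons]; congr 1; omega

/-- The iterated ultrafilter limit of the values of `val` along a word. -/
noncomputable def limitValue [Finite K] (val : S → K) (step : A → ℕ → S → S) : List A → S → K
  | [], s => val s
  | a :: w, s => (exists_ultralimit fun i => limitValue val step w (step a i s)).choose

theorem limitValue_cons [Finite K] (val : S → K) (step : A → ℕ → S → S) (a : A) (w : List A)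
    (s : S) :
    ∀ᶠ i in hyperfilter ℕ,
      limitValue val step w (step a i s) = limitValue val step (a :: w) s :=
  (exists_ultralimit fun i => limitValue val step w (step a i s)).choose_spec

theorem limitValue_filter [Finite K] (val : S → K) (step : A → ℕ → S → S) (p : A → Bool)
    (hp : ∀ a, p a = false → ∀ i s, step a i s = s) (w : List A) (s : S) :
    limitValue val step (w.filter p) s = limitValue val step w s := by
  induction w generalizing s with
  | nil => rfl
  | cons a w ih =>
    cases ha : p a with
    | false =>
      rw [List.filter_cons_of_neg (by simp [ha]), ih]
      obtain ⟨i, hi⟩ := (limitValue_cons val step a w s).exists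
      rw [← hi, hp a ha]
    | true =>
      rw [List.filter_cons_of_pos ha]
      obtain ⟨i, hi, hi'⟩ := ((limitValue_cons val step a w s).and
        (limitValue_cons val step a (w.filter p) s)).exists
      rw [← hi, ← hi', ih]

/-- A form of Ramsey's theorem: along a suitable subsequence, the final value of a run of bounded
length only depends on the word. -/
theorem exists_strictMono_runWord [Finite K] [Finite A] (val : S → K) (step : A → ℕ → S → S)
    (s₀ : S) (N : ℕ) :
    ∃ h : ℕ → ℕ, StrictMono h ∧ ∀ w : List A, w.length ≤ N →
      val (runWord step h 0 s₀ w) = limitValue val step w s₀ := by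
  classical
  have hnext : ∀ (R : Finset S) (b : ℕ), ∃ i, b < i ∧ ∀ s ∈ R, ∀ a : A, ∀ w : List A,
      w.length ≤ N → limitValue val step w (step a i s) = limitValue val step (a :: w) s := by
    intro R b
    have h1 : ∀ᶠ i in hyperfilter ℕ, b < i :=
      Nat.hyperfilter_le_atTop (eventually_gt_atTop b)
    have h2 : ∀ᶠ i in hyperfilter ℕ, ∀ s ∈ (R : Set S), ∀ a ∈ (univ : Set A),
        ∀ w ∈ {w : List A | w.length ≤ N},
          limitValue val step w (step a i s) = limitValue val step (a :: w) s := by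
      rw [eventually_all_finite R.finite_toSet]
      intro s _
      rw [eventually_all_finite (Set.toFinite _)]
      intro a _
      rw [eventually_all_finite (List.finite_length_le A N)]
      exact fun w _ => limitValue_cons val step a w s
    obtain ⟨i, hi, hi'⟩ := (h1.and h2).exists
    exact ⟨i, hi, fun s hs a w hw => hi' s hs a (mem_univ a) w hw⟩
  choose next hlt hgood using hnext
  have := Fintype.ofFinite A
  let F : Finset S × ℕ → Finset S × ℕ := fun x =>
    ((Finset.univ ×ˢ x.1).image fun y : A × S => step y.1 (next x.1 x.2) y.2, next x.1 x.2)
  let X : ℕ → Finset S × ℕ := fun k => F^[k] ({s₀}, 0)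
  have hX : ∀ k, X (k + 1) = F (X k) := fun k => Function.iterate_succ_apply' _ _ _
  let h : ℕ → ℕ := fun k => (X (k + 1)).2
  have hh : ∀ k, h k = next (X k).1 (X k).2 := fun k => by simp only [h, hX, F]
  refine ⟨h, strictMono_nat_of_lt_succ fun k => ?_, ?_⟩
  · rw [hh (k + 1)]
    exact hlt _ _
  · have key : ∀ (w : List A) (k : ℕ) (s : S), w.length ≤ N → s ∈ (X k).1 →
        val (runWord step h k s w) = limitValue val step w s := by
      intro w
      induction w with
      | nil => intros; rfl
      | cons a w ih =>
        intro k s hw hs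
        have hw' : w.length ≤ N := (Nat.le_succ _).trans hw
        rw [runWord, ih _ _ hw', hh, hgood _ _ s hs a w hw']
        rw [hX, hh]
        exact Finset.mem_image.2 ⟨(a, s), by simpa using hs, rfl⟩
    exact fun w hw => key w 0 s₀ hw (by simp [X])

/-- From any sequence `c` of group elements and any sequence of finite colourings of the group
one can select indices along which the products of the even-indexed and of the odd-indexed
elements over a set `v` get the same colour at each position outside `v`. -/
theorem exists_strictMono_prod_eq {G : Type*} [CommGroup G] [Finite K] (cls : ℕ → G → K)
    (c : ℕ → G) (n : ℕ) :
    ∃ h : ℕ → ℕ, StrictMono h ∧ ∀ v ⊆ Finset.range n, ∀ m < n, m ∉ v →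
      cls (h (2 * m)) (∏ i ∈ v, c (h (2 * i))) =
        cls (h (2 * m)) (∏ i ∈ v, c (h (2 * i + 1))) := by
  classical
  let step : Option Bool → ℕ → ℕ × G → ℕ × G := fun a i s =>
    match a with
    | none => s
    | some true => (i, s.2)
    | some false => (s.1, s.2 * c i)
  obtain ⟨h, hmono, hh⟩ := exists_strictMono_runWord (fun s : ℕ × G => cls s.1 s.2) step (0, 1)
    (2 * n)
  refine ⟨h, hmono, fun v hv m hm hmv => ?_⟩
  let W : (ℕ → List (Option Bool)) → ℕ → List (Option Bool) := fun blk n =>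
    (List.range n).flatMap blk
  have hW : ∀ blk n, W blk (n + 1) = W blk n ++ blk n := fun blk n => by
    simp [W, List.range_succ]
  let b₀ : ℕ → List (Option Bool) := fun i =>
    if i = m then [some true, none] else if i ∈ v then [some false, none] else [none, none]
  let b₁ : ℕ → List (Option Bool) := fun i =>
    if i = m then [some true, none] else if i ∈ v then [none, some false] else [none, none]
  have len₀ : ∀ n, (W b₀ n).length = 2 * n := by
    intro n
    induction n with
    | zero => rfl
    | succ n ih => rw [hW, List.length_append, ih]; simp only [b₀]; split_ifs <;> rfl
  have len₁ : ∀ n, (W b₁ n).length = 2 * n := by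
    intro n
    induction n with
    | zero => rfl
    | succ n ih => rw [hW, List.length_append, ih]; simp only [b₁]; split_ifs <;> rfl
  have hfilter : ∀ n, (W b₀ n).filter Option.isSome = (W b₁ n).filter Option.isSome := by
    intro n
    induction n with
    | zero => rfl
    | succ n ih =>
      rw [hW, hW, List.filter_append, List.filter_append, ih]
      simp only [b₀, b₁]; split_ifs <;> rfl
  have run₀ : ∀ n, runWord step h 0 (0, 1) (W b₀ n) =
      (if m < n then h (2 * m) else 0,
        ∏ i ∈ Finset.range n, if i ∈ v then c (h (2 * i)) else 1) := by
    intro n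
    induction n with
    | zero => rfl
    | succ n ih =>
      rw [hW, runWord_append, ih, len₀, Finset.prod_range_succ]
      by_cases h1 : n = m
      · subst h1
        simp [b₀, runWord, step, hmv]
      · have : m < n + 1 ↔ m < n := by omega
        by_cases h2 : n ∈ v <;> simp [b₀, runWord, step, h1, h2, this]
  have run₁ : ∀ n, runWord step h 0 (0, 1) (W b₁ n) =
      (if m < n then h (2 * m) else 0,
        ∏ i ∈ Finset.range n, if i ∈ v then c (h (2 * i + 1)) else 1) := by
    intro n
    induction n with
    | zero => rfl
    | succ n ih =>
      rw [hW, runWord_append, ih, len₁, Finset.prod_range_succ]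
      by_cases h1 : n = m
      · subst h1
        simp [b₁, runWord, step, hmv]
      · have : m < n + 1 ↔ m < n := by omega
        by_cases h2 : n ∈ v <;> simp [b₁, runWord, step, h1, h2, this]
  have hskip : ∀ a : Option Bool, a.isSome = false → ∀ i s, step a i s = s := by
    rintro (_ | _) ha i s
    · rfl
    · simp at ha
  have e₀ := hh (W b₀ n) (len₀ n).le
  have e₁ := hh (W b₁ n) (len₁ n).le
  rw [← limitValue_filter _ _ _ hskip, hfilter, limitValue_filter _ _ _ hskip, ← e₁, run₀,
    run₁] at e₀
  simpa [hm, Finset.prod_ite_mem, Finset.inter_eq_right.2 hv] using e₀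

/-- If `Q i` contains all quotients of elements of the same `cls i`-colour, while for `i < j` the
product of `(c i)⁻¹ * c j` and such a quotient is never in `Q i`, then along suitable indices `h m`
all patterns of membership on `n` positions are realized. -/
theorem exists_patterns {G : Type*} [CommGroup G] [Finite K] (cls : ℕ → G → K)
    (Q : ℕ → Set G) (c : ℕ → G)
    (hQ : ∀ i y z, cls i y = cls i z → y⁻¹ * z ∈ Q i)
    (hc : ∀ i j, i < j → ∀ y z, cls i y = cls i z → (c i)⁻¹ * c j * (y⁻¹ * z) ∉ Q i) (n : ℕ) :
    ∃ h : ℕ → ℕ, ∀ v ⊆ Finset.range n, ∃ b : G, ∀ m < n, b ∈ Q (h m) ↔ m ∉ v := by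
  obtain ⟨h, hmono, hh⟩ := exists_strictMono_prod_eq cls c n
  refine ⟨fun m => h (2 * m), fun v hv =>
    ⟨(∏ i ∈ v, c (h (2 * i)))⁻¹ * ∏ i ∈ v, c (h (2 * i + 1)), fun m hm => ⟨?_, ?_⟩⟩⟩
  · intro hb hmv
    have hsub : v.erase m ⊆ Finset.range n := (Finset.erase_subset _ _).trans hv
    refine hc (h (2 * m)) (h (2 * m + 1)) (hmono (by omega)) _ _
      (hh (v.erase m) hsub m hm (Finset.notMem_erase _ _)) ?_
    rw [← Finset.mul_prod_erase v (fun i => c (h (2 * i))) hmv,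
      ← Finset.mul_prod_erase v (fun i => c (h (2 * i + 1))) hmv] at hb
    convert hb using 1
    simp only [mul_inv]
    exact mul_mul_mul_comm _ _ _ _
  · exact fun hmv => hQ _ _ _ (hh v hv m hm hmv)

end Combinatorics

section Definability

variable {β γ : Type*}

/-- The predicate `X` on valuations of the variables `β` is definable over `A`. -/
def DefinablePred (L : FirstOrder.Language.{u, u}) {M : Type u} [L.Structure M] (A : Set M)
    (X : (β → M) → Prop) : Prop :=
  ∃ φ : L.Formula (A ⊕ β), ∀ v : β → M, φ.Realize (Sum.elim (↑) v) ↔ X v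

namespace DefinablePred

variable {A : Set M} {X Y : (β → M) → Prop}

theorem and (hX : DefinablePred L A X) (hY : DefinablePred L A Y) :
    DefinablePred L A fun v => X v ∧ Y v := by
  obtain ⟨φ, hφ⟩ := hX
  obtain ⟨ψ, hψ⟩ := hY
  exact ⟨φ ⊓ ψ, fun v => by rw [Language.Formula.realize_inf, hφ, hψ]⟩

theorem iff (hX : DefinablePred L A X) (hY : DefinablePred L A Y) :
    DefinablePred L A fun v => (X v ↔ Y v) := by
  obtain ⟨φ, hφ⟩ := hX
  obtain ⟨ψ, hψ⟩ := hY
  exact ⟨φ.iff ψ, fun v => by rw [Language.Formula.realize_iff, hφ, hψ]⟩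

theorem const (A : Set M) (p : Prop) : DefinablePred L A fun _ : β → M => p := by
  by_cases hp : p
  · exact ⟨⊤, fun v => by simp [hp]⟩
  · exact ⟨⊥, fun v => by simp [hp]⟩

theorem comp (f : β → γ) (hX : DefinablePred L A X) :
    DefinablePred L A fun v : γ → M => X fun i => v (f i) := by
  obtain ⟨φ, hφ⟩ := hX
  refine ⟨φ.relabel (Sum.map id f), fun v => ?_⟩
  rw [Language.Formula.realize_relabel, Sum.elim_comp_map]
  exact hφ _

theorem ex {X : (β → M) → M → Prop}
    (hX : DefinablePred L A fun v : Option β → M => X (fun i => v (some i)) (v none)) :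
    DefinablePred L A fun v => ∃ b, X v b := by
  obtain ⟨φ, hφ⟩ := hX
  let g : A ⊕ Option β → (A ⊕ β) ⊕ Unit :=
    Sum.elim (fun a => .inl (.inl a)) fun o => o.elim (.inr ()) fun i => .inl (.inr i)
  refine ⟨(φ.relabel g).iExs Unit, fun v => ?_⟩
  rw [Language.Formula.realize_iExs]
  have : ∀ y : Unit → M, (φ.relabel g).Realize (Sum.elim (Sum.elim (↑) v) y) ↔ X v (y ()) := by
    intro y
    rw [Language.Formula.realize_relabel]
    refine Iff.trans ?_ (hφ fun o => o.elim (y ()) v)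
    refine iff_of_eq (congrArg _ (funext ?_))
    rintro (a | _ | i) <;> rfl
  simp only [this]
  exact ⟨fun ⟨y, hy⟩ => ⟨_, hy⟩, fun ⟨b, hb⟩ => ⟨fun _ => b, hb⟩⟩

theorem finset_forall {I : Type*} (s : Finset I) {X : I → (β → M) → Prop}
    (hX : ∀ i ∈ s, DefinablePred L A (X i)) : DefinablePred L A fun v => ∀ i ∈ s, X i v := by
  classical
  induction s using Finset.induction_on with
  | empty => simpa using const A True
  | insert a s _ ih =>
    simp only [Finset.forall_mem_insert]
    exact (hX a (Finset.mem_insert_self _ _)).and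
      (ih fun i hi => hX i (Finset.mem_insert_of_mem hi))

theorem of_formula {ι : Type*} (φ : L.Formula ι) (f : ι → β) :
    DefinablePred L A fun v : β → M => φ.Realize fun i => v (f i) :=
  ⟨φ.relabel fun i => .inr (f i), fun v => by rw [Language.Formula.realize_relabel]; rfl⟩

theorem of_paramFormula {n : ℕ} {f : ParamFormula L M n} (hf : f.paramsIn A) (e : Fin n → β) :
    DefinablePred L A fun v : β → M => f.Realize fun i => v (e i) := by
  refine ⟨f.toFormula.relabel (Sum.elim (fun i => .inr (e i)) fun j => .inl ⟨f.params j, hf j⟩),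
    fun v => ?_⟩
  rw [Language.Formula.realize_relabel]
  refine iff_of_eq (congrArg _ (funext ?_))
  rintro (a | i) <;> rfl

end DefinablePred

/-- The truth of a formula only depends on the values of finitely many variables. -/
theorem exists_finset_support (φ : L.Formula β) :
    ∃ (F : Finset β) (ψ : L.Formula F), ∀ v : β → M, φ.Realize v ↔ ψ.Realize fun i => v i := by
  classical
  refine ⟨φ.freeVarFinset, φ.restrictFreeVar id, fun v => ?_⟩
  exact (Language.BoundedFormula.realize_restrictFreeVar (φ := φ) (f := id)
    (v := fun i => v i) v fun a => rfl).symm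

/-- A formula in one distinguished variable and arbitrarily many others is a formula in which
only finitely many of the others occur, used as parameters. -/
theorem exists_param_formula (φ : L.Formula (Option γ)) :
    ∃ (m : ℕ) (ψ : L.Formula (Fin 1 ⊕ Fin m)) (vs : Fin m → γ), ∀ (v : γ → M) (b : M),
      φ.Realize (fun o => o.elim b v) ↔ ψ.Realize (Sum.elim (fun _ => b) fun i => v (vs i)) := by
  classical
  obtain ⟨F, ψ, hψ⟩ := exists_finset_support (M := M) φ
  let F' := F.eraseNone
  let e := F'.equivFin
  let g : F → Fin 1 ⊕ Fin F'.card := fun x =>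
    match x with
    | ⟨none, _⟩ => .inl 0
    | ⟨some c, hc⟩ => .inr (e ⟨c, Finset.mem_eraseNone.2 hc⟩)
  refine ⟨F'.card, ψ.relabel g, fun i => e.symm i, fun v b => ?_⟩
  rw [hψ, Language.Formula.realize_relabel]
  refine iff_of_eq (congrArg _ (funext ?_))
  rintro ⟨_ | c, hc⟩
  · rfl
  · simp [g]

end Definability

section Compactness

open Filter

variable {P : Type u}

/-- Existence of a continuation: the formula expressing that the assignment `a` on the first `n`
variables, extended by `b`, extends to a solution of `φ`. -/
theorem exists_formula_extension (φ : L.Formula (P ⊕ ℕ)) (n : ℕ) :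
    ∃ ψ : L.Formula (Option (P ⊕ Fin n)), ∀ (w : P → M) (a : ℕ → M) (b : M),
      ψ.Realize (fun o => o.elim b (Sum.elim w fun i => a i)) ↔
        ∃ x : ℕ → M, φ.Realize (Sum.elim w x) ∧ (∀ i < n, x i = a i) ∧ x n = b := by
  classical
  obtain ⟨F, θ, hθ⟩ := exists_finset_support (M := M) φ
  obtain ⟨N, hN⟩ : ∃ N, ∀ i, Sum.inr i ∈ F → i < N := by
    refine ⟨F.toRight.sup id + 1, fun i hi => Nat.lt_succ_of_le ?_⟩
    exact Finset.le_sup (f := id) (Finset.mem_toRight.2 hi)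
  let g : P ⊕ ℕ → Option (P ⊕ Fin n) ⊕ Fin N :=
    Sum.elim (fun p => .inl (some (.inl p))) fun i =>
      if h : i < n then .inl (some (.inr ⟨i, h⟩)) else
      if i = n then .inl none else
      if h : i < N then .inr ⟨i, h⟩ else .inl none
  refine ⟨(φ.relabel g).iExs (Fin N), fun w a b => ?_⟩
  rw [Language.Formula.realize_iExs]
  simp only [Language.Formula.realize_relabel]
  constructor
  · rintro ⟨y, hy⟩
    refine ⟨fun i => if h : i < n then a i else if i = n then b else
      if h : i < N then y ⟨i, h⟩ else b, ?_, fun i hi => by simp [hi], by simp⟩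
    convert hy using 1
    funext o
    rcases o with p | i
    · rfl
    · simp only [Sum.elim_inr, Function.comp_apply, g]
      split_ifs <;> rfl
  · rintro ⟨x, hx, hxa, hxb⟩
    refine ⟨fun i => x i, ?_⟩
    rw [hθ] at hx ⊢
    convert hx using 1
    funext ⟨o, ho⟩
    rcases o with p | i
    · rfl
    · have hi := hN i ho
      simp only [Sum.elim_inr, Function.comp_apply, g, hi, dite_true]
      split_ifs with h1 h2
      · simp [hxa i h1]
      · simp [h2, hxb]
      · rfl

/-- In a saturated structure, an ultrafilter on assignments of countably many variables
has a realized limit type over any small valuation of parameters. -/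
theorem Saturated.exists_realize_ultrafilter {κ : Cardinal.{u}} (hκ : ℵ₀ < κ)
    (hsat : Saturated L M κ) (hP : #P < κ) (w : P → M) (U : Ultrafilter (ℕ → M)) :
    ∃ a : ℕ → M, ∀ φ : L.Formula (P ⊕ ℕ), (∀ᶠ x in U, φ.Realize (Sum.elim w x)) →
      φ.Realize (Sum.elim w a) := by
  classical
  obtain ⟨x₀⟩ : Nonempty (ℕ → M) := U.neBot.nonempty
  have : Nonempty M := ⟨x₀ 0⟩
  let Inv : ℕ → (ℕ → M) → Prop := fun n a => ∀ φ : L.Formula (P ⊕ ℕ),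
    (∀ᶠ x in U, φ.Realize (Sum.elim w x)) →
      ∃ x : ℕ → M, φ.Realize (Sum.elim w x) ∧ ∀ i < n, x i = a i
  have step : ∀ n a, Inv n a → ∃ b, Inv (n + 1) (Function.update a n b) := by
    intro n a ha
    let B : Set M := range w ∪ a '' Iio n
    have hB : #B < κ := by
      refine (mk_union_le _ _).trans_lt (add_lt_of_lt hκ.le (mk_range_le.trans_lt hP) ?_)
      exact (((finite_Iio n).image a).lt_aleph0).trans hκ
    let p : Set (ParamFormula L M 1) := {f | f.paramsIn B ∧ ∃ φ : L.Formula (P ⊕ ℕ),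
      (∀ᶠ x in U, φ.Realize (Sum.elim w x)) ∧ ∀ b, (f.Realize fun _ => b) ↔
        ∃ x : ℕ → M, φ.Realize (Sum.elim w x) ∧ (∀ i < n, x i = a i) ∧ x n = b}
    obtain ⟨b, hb⟩ := hsat B hB p (fun f hf => hf.1) (by
      intro s hs hfin
      have : Finite s := hfin
      choose φ hφU hφ using fun f : s => (hs f.2).2
      obtain ⟨x, hx, hxa⟩ := ha (Language.Formula.iInf φ) (by
        simp only [Language.Formula.realize_iInf]
        exact eventually_all.2 hφU)
      rw [Language.Formula.realize_iInf] at hx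
      exact ⟨x n, fun f hf => (hφ ⟨f, hf⟩ _).2 ⟨x, hx ⟨f, hf⟩, hxa, rfl⟩⟩)
    refine ⟨b, fun φ hφ => ?_⟩
    obtain ⟨ψ, hψ⟩ := exists_formula_extension (M := M) φ n
    obtain ⟨m, χ, vs, hχ⟩ := exists_param_formula (M := M) ψ
    obtain ⟨x, hx, hxa, hxb⟩ := (hψ w a b).1 ((hχ _ b).2 (hb
      ⟨m, χ, fun j => Sum.elim w (fun i : Fin n => a i) (vs j)⟩ ⟨fun j => by
        change Sum.elim w (fun i : Fin n => a i) (vs j) ∈ B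
        rcases vs j with q | i
        · exact .inl ⟨q, rfl⟩
        · exact .inr ⟨i, i.2, rfl⟩, φ, hφ, fun b' => (hχ _ b').symm.trans (hψ w a b')⟩))
    refine ⟨x, hx, fun i hi => ?_⟩
    rcases Nat.lt_succ_iff_lt_or_eq.1 hi with h | rfl
    · rw [hxa i h, Function.update_of_ne h.ne]
    · simpa using hxb
  choose! next hnext using step
  let A : ℕ → ℕ → M := fun n => n.rec x₀ fun k a => Function.update a k (next k a)
  have hA : ∀ n, Inv n (A n) := by
    intro n
    induction n with
    | zero =>
      intro φ hφ
      obtain ⟨x, hx⟩ := hφ.exists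
      exact ⟨x, hx, by simp⟩
    | succ n ih => exact hnext n _ ih
  have hstab : ∀ n i, i < n → A n i = A (i + 1) i := by
    intro n i hi
    induction n, hi using Nat.le_induction with
    | base => rfl
    | succ k hk ih =>
      rw [← ih]
      exact Function.update_of_ne (by omega) _ _
  refine ⟨fun i => A (i + 1) i, fun φ hφ => ?_⟩
  obtain ⟨F, θ, hθ⟩ := exists_finset_support (M := M) φ
  obtain ⟨x, hx, hxa⟩ := hA (F.toRight.sup id + 1) φ hφ
  rw [hθ] at hx ⊢
  convert hx using 1
  funext ⟨o, ho⟩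
  rcases o with q | i
  · rfl
  · have hi : i < F.toRight.sup id + 1 :=
      Nat.lt_succ_of_le (Finset.le_sup (f := id) (Finset.mem_toRight.2 ho))
    exact ((hxa i hi).trans (hstab _ i hi)).symm

/-- Compactness for directed families of definable conditions on countably many variables. -/
theorem Saturated.exists_forall {κ : Cardinal.{u}} (hκ : ℵ₀ < κ) (hsat : Saturated L M κ)
    {A : Set M} (hA : #A < κ) (hP : #P < κ) (w : P → M) {I : Type*} [Preorder I]
    [IsDirected I (· ≤ ·)] [Nonempty I] {X : I → (P ⊕ ℕ → M) → Prop}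
    (hX : ∀ t, DefinablePred L A (X t)) (hmono : ∀ s t, s ≤ t → ∀ v, X t v → X s v)
    (hne : ∀ t, ∃ x : ℕ → M, X t (Sum.elim w x)) :
    ∃ x : ℕ → M, ∀ t, X t (Sum.elim w x) := by
  have : NeBot (⨅ t, 𝓟 {x : ℕ → M | X t (Sum.elim w x)}) := by
    refine iInf_neBot_of_directed' (fun s t => ?_) fun t => principal_neBot_iff.2 (hne t)
    obtain ⟨r, hs, ht⟩ := exists_ge_ge s t
    exact ⟨r, principal_mono.2 fun x => hmono _ _ hs _, principal_mono.2 fun x => hmono _ _ ht _⟩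
  obtain ⟨a, ha⟩ := hsat.exists_realize_ultrafilter (P := A ⊕ P) hκ
    (by rw [mk_sum, lift_id, lift_id]; exact add_lt_of_lt hκ.le hA hP) (Sum.elim (↑) w)
    (Ultrafilter.of (⨅ t, 𝓟 {x : ℕ → M | X t (Sum.elim w x)}))
  refine ⟨a, fun t => ?_⟩
  obtain ⟨φ, hφ⟩ := hX t
  have key : ∀ x : ℕ → M, (φ.relabel (Equiv.sumAssoc A P ℕ).symm).Realize
      (Sum.elim (Sum.elim (↑) w) x) ↔ X t (Sum.elim w x) := by
    intro x
    rw [← hφ, Language.Formula.realize_relabel]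
    refine iff_of_eq (congrArg _ (funext ?_))
    rintro (a | p | i) <;> rfl
  refine (key a).1 (ha _ ?_)
  simp only [key]
  exact Ultrafilter.of_le _ (mem_iInf_of_mem t (mem_principal_self _))

/-- Compactness for directed families of definable conditions on two variables. -/
theorem Saturated.exists_pair {κ : Cardinal.{u}} (hκ : ℵ₀ < κ) (hsat : Saturated L M κ)
    {A : Set M} (hA : #A < κ) (hP : #P < κ) (w : P → M) {I : Type*} [Preorder I]
    [IsDirected I (· ≤ ·)] [Nonempty I] {X : I → (P → M) → M → M → Prop}
    (hX : ∀ t, DefinablePred L A fun v : Option (Option P) → M =>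
      X t (fun p => v (some (some p))) (v (some none)) (v none))
    (hmono : ∀ s t, s ≤ t → ∀ v x y, X t v x y → X s v x y) (hne : ∀ t, ∃ x y, X t w x y) :
    ∃ x y, ∀ t, X t w x y := by
  obtain ⟨x, hx⟩ := hsat.exists_forall hκ hA hP w
    (X := fun t v => X t (fun p => v (.inl p)) (v (.inr 0)) (v (.inr 1)))
    (fun t => (hX t).comp (γ := P ⊕ ℕ) fun o =>
      o.elim (Sum.inr 1) fun o => o.elim (Sum.inr 0) Sum.inl)
    (fun s t hst v => hmono s t hst _ _ _)
    (fun t => by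
      obtain ⟨x, y, h⟩ := hne t
      exact ⟨fun i => if i = 0 then x else y, by simpa using h⟩)
  exact ⟨x 0, x 1, hx⟩

/-- In a dependent theory no definable relation realizes all patterns on arbitrarily long
finite sequences of parameters. -/
theorem IsDependent.not_patterns {κ : Cardinal.{u}} (hκ : ℵ₀ < κ) (hsat : Saturated L M κ)
    (hdep : IsDependent L M) {A : Set M} {X : (P → M) → M → Prop}
    (hX : DefinablePred L A fun v : Option P → M => X (fun p => v (some p)) (v none)) :
    ∃ n : ℕ, ∀ w : ℕ → P → M, ∃ u ⊆ Finset.range n, ∀ b, ∃ i < n, ¬(X (w i) b ↔ i ∈ u) := by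
  by_contra! H
  obtain ⟨φ, hφ⟩ := hX
  let g : A ⊕ Option P → Option (A ⊕ P) :=
    Sum.elim (fun a => some (.inl a)) fun o => o.map .inr
  obtain ⟨m, ψ, vs, hψ⟩ := exists_param_formula (M := M) (φ.relabel g)
  let as : (P → M) → Fin m → M := fun w j => Sum.elim (↑) w (vs j)
  have hψX : ∀ w b, ψ.Realize (Sum.elim (fun _ => b) (as w)) ↔ X w b := by
    intro w b
    rw [← hψ, Language.Formula.realize_relabel]
    refine Iff.trans ?_ (hφ fun o => o.elim b w)
    refine iff_of_eq (congrArg _ (funext ?_))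
    rintro (a | _ | i) <;> rfl
  obtain ⟨x, hx⟩ := hsat.exists_forall (P := PEmpty) (A := ∅) hκ
    (by simpa using aleph0_pos.trans hκ) (by simpa using aleph0_pos.trans hκ) PEmpty.elim
    (X := fun n v => ∀ u ∈ (Finset.range n).powerset, ∃ b, ∀ i ∈ Finset.range n,
      (ψ.Realize (Sum.elim (fun _ => b) fun j => v (.inr (Nat.pair i j))) ↔ i ∈ u))
    (fun n => by
      refine .finset_forall _ fun u _ => .ex (.finset_forall _ fun i _ => .iff ?_ (.const _ _))
      have := DefinablePred.of_formula (M := M) (A := (∅ : Set M)) ψ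
        (Sum.elim (fun _ => none) fun j : Fin m => some (.inr (Nat.pair i j)) :
          _ → Option (PEmpty.{u + 1} ⊕ ℕ))
      convert this using 3 with v
      funext o
      rcases o with _ | _ <;> rfl)
    (fun s t hst v h u hu => by
      have hst' : Finset.range s ⊆ Finset.range t := Finset.range_subset_range.2 hst
      obtain ⟨b, hb⟩ := h u (Finset.mem_powerset.2 ((Finset.mem_powerset.1 hu).trans hst'))
      exact ⟨b, fun i hi => hb i (hst' hi)⟩)
    (fun n => by
      obtain ⟨w, hw⟩ := H n
      refine ⟨fun k => if h : (Nat.unpair k).2 < m then as (w (Nat.unpair k).1) ⟨_, h⟩ else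
        (hw ∅ (by simp)).choose, fun u hu => ?_⟩
      obtain ⟨b, hb⟩ := hw u (Finset.mem_powerset.1 hu)
      refine ⟨b, fun i hi => ?_⟩
      rw [← hb i (Finset.mem_range.1 hi), ← hψX]
      simp)
  refine hdep 1 m ψ (fun i j => x (Nat.pair i j)) fun u s => ?_
  classical
  obtain ⟨b, hb⟩ := hx (s.sup id + 1) ((Finset.range (s.sup id + 1)).filter (· ∈ u)) (by simp)
  refine ⟨fun _ => b, fun i hi => ?_⟩
  have hi' : i < s.sup id + 1 := Nat.lt_succ_of_le (Finset.le_sup (f := id) hi)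
  simpa [hi'] using hb i (Finset.mem_range.2 hi')

end Compactness

section Cardinality

/-- A formula in one object variable whose parameters are entries of a tuple indexed by `α`. -/
def TupleFormula (L : FirstOrder.Language.{u, u}) (α : Type u) : Type u :=
  (m : ℕ) × L.Formula (Fin 1 ⊕ Fin m) × (Fin m → α)

/-- The truth of a tuple formula at `y`, the tuple being `w`. -/
def TupleFormula.Realize {α : Type u} (j : TupleFormula L α) (w : α → M) (y : M) : Prop :=
  j.2.1.Realize (Sum.elim (fun _ => y) fun i => w (j.2.2 i))

theorem aleph0_le_theoryCard : ℵ₀ ≤ theoryCard L := le_sup_left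

theorem mk_sigma_le {I : Type u} {F : I → Type u} {μ : Cardinal.{u}} (hμ : ℵ₀ ≤ μ) (hI : #I ≤ μ)
    (hF : ∀ i, #(F i) ≤ μ) : #(Σ i, F i) ≤ μ := by
  rw [mk_sigma]
  refine (sum_le_sum _ (fun _ => μ) hF).trans ?_
  rw [sum_const, lift_id, lift_id]
  exact mul_le_of_le hμ hI le_rfl

theorem TupleFormula.mk_le (α : Type u) : #(TupleFormula L α) ≤ #α ⊔ theoryCard L := by
  have hμ : ℵ₀ ≤ #α ⊔ theoryCard L := aleph0_le_theoryCard.trans le_sup_right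
  have hF : ∀ m : ℕ, #(L.Formula (Fin 1 ⊕ Fin m)) ≤ #α ⊔ theoryCard L := by
    intro m
    have h1 : #(L.Formula (Fin 1 ⊕ Fin m)) ≤ #(Σ n, L.BoundedFormula (Fin 1 ⊕ Fin m) n) :=
      mk_le_of_injective (f := fun φ => (⟨0, φ⟩ : Σ n, L.BoundedFormula (Fin 1 ⊕ Fin m) n))
        fun _ _ h => eq_of_heq (Sigma.mk.inj h).2
    refine h1.trans (Language.BoundedFormula.card_le.trans (max_le hμ (add_le_of_le hμ ?_ ?_)))
    · exact le_trans (by simp) hμ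
    · rw [lift_id']
      exact le_sup_right.trans (le_sup_right : theoryCard L ≤ _)
  have hS : #(TupleFormula L α) =
      #((m : ULift.{u} ℕ) × L.Formula (Fin 1 ⊕ Fin m.down) × (Fin m.down → α)) :=
    mk_congr (Equiv.sigmaCongrLeft' Equiv.ulift.symm)
  rw [hS]
  refine mk_sigma_le hμ (by simpa using hμ) fun m => ?_
  rw [mk_prod, lift_id, lift_id]
  refine mul_le_of_le hμ (hF _) ?_
  rw [mk_pi, prod_const]
  have h2 : #α ^ m.down ≤ #α ⊔ theoryCard L :=
    (pow_le_pow_left' le_sup_left _).trans (power_nat_le hμ)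
  simpa using h2

theorem DefGroup.mk_pStar_le (D : DefGroup L M) : #D.pStar ≤ #D.AStar ⊔ theoryCard L := by
  refine le_trans ?_ (TupleFormula.mk_le (L := L) D.AStar)
  refine mk_le_of_injective (f := fun f : D.pStar =>
    (⟨f.1.m, f.1.toFormula, fun i => ⟨f.1.params i, D.pStar_over f.1 f.2 i⟩⟩ :
      TupleFormula L D.AStar)) ?_
  rintro ⟨⟨m, φ, p⟩, hf⟩ ⟨⟨m', φ', p'⟩, hf'⟩ h
  obtain ⟨rfl, h⟩ := Sigma.mk.inj h
  obtain ⟨rfl, h⟩ := Prod.mk.inj (eq_of_heq h)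
  obtain rfl : p = p' := funext fun i => congrArg Subtype.val (congrFun h i)
  rfl

theorem mk_finset_le {I : Type u} {μ : Cardinal.{u}} (hμ : ℵ₀ ≤ μ) (hI : #I ≤ μ) :
    #(Finset I) ≤ μ := by
  cases finite_or_infinite I
  · exact (lt_aleph0_of_finite _).le.trans hμ
  · rwa [mk_finset_of_infinite]

end Cardinality

namespace DefGroup

variable (D : DefGroup L M) {α : Type u} {β : Type*}

/-- The group structure on the set of realizations of the type defining an abelian group. -/
@[reducible]
def commGroup (habel : D.IsAbelian) : CommGroup D.carrier where
  mul x y := ⟨D.mul x y, D.mul_mem' x x.2 y y.2⟩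
  one := ⟨D.one, D.one_mem'⟩
  inv x := ⟨D.inv x, D.inv_mem' x x.2⟩
  mul_assoc x y z := Subtype.ext (D.mul_assoc' x x.2 y y.2 z z.2)
  one_mul x := Subtype.ext (D.one_mul' x x.2)
  mul_one x := Subtype.ext (D.mul_one' x x.2)
  inv_mul_cancel x := Subtype.ext (D.inv_mul' x x.2)
  mul_comm x y := Subtype.ext (habel x x.2 y y.2)

/-- Two elements of the group with the same type over a tuple. -/
def SameTypeOver (w : α → M) (y z : M) : Prop :=
  y ∈ D.carrier ∧ z ∈ D.carrier ∧
    ∀ f : ParamFormula L M 1, f.paramsIn (range w) →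
      ((f.Realize fun _ => y) ↔ (f.Realize fun _ => z))

theorem mem_qTupleSet_zero {w : α → M} {c : M} : c ∈ D.qTupleSet w 0 ↔ c = D.one := by
  refine ⟨fun ⟨d, _, _, h⟩ => by simpa using h, fun h => ⟨Fin.elim0, ?_, ?_, by simpa using h⟩⟩
  · exact fun i => i.elim0
  · exact fun i => i.elim0

theorem mem_qTupleSet_succ {w : α → M} {k : ℕ} {c : M} : c ∈ D.qTupleSet w (k + 1) ↔
    ∃ y z, D.SameTypeOver w y z ∧ ∃ c' ∈ D.qTupleSet w k, c = D.mul (D.mul (D.inv y) z) c' := by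
  constructor
  · rintro ⟨d, hd, hsame, rfl⟩
    refine ⟨(d 0).1, (d 0).2, ⟨(hd 0).1, (hd 0).2, hsame 0⟩, _,
      ⟨fun i => d i.succ, fun i => hd _, fun i => hsame _, rfl⟩, ?_⟩
    rw [List.ofFn_succ, List.foldr_cons]
  · rintro ⟨y, z, ⟨hy, hz, hyz⟩, _, ⟨d, hd, hsame, rfl⟩, rfl⟩
    refine ⟨Fin.cons (y, z) d, Fin.cases ⟨hy, hz⟩ hd, Fin.cases hyz hsame, ?_⟩
    rw [List.ofFn_succ, List.foldr_cons]
    rfl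

theorem qTupleSet_subset_carrier (w : α → M) (k : ℕ) : D.qTupleSet w k ⊆ D.carrier := by
  induction k with
  | zero =>
    intro c hc
    rw [D.mem_qTupleSet_zero.1 hc]
    exact D.one_mem'
  | succ k ih =>
    intro c hc
    obtain ⟨y, z, h, c', hc', rfl⟩ := D.mem_qTupleSet_succ.1 hc
    exact D.mul_mem' _ (D.mul_mem' _ (D.inv_mem' _ h.1) _ h.2.1) _ (ih hc')

theorem qTupleSet_mono (w : α → M) : Monotone (D.qTupleSet w) := by
  refine monotone_nat_of_le_succ fun k c hc => D.mem_qTupleSet_succ.2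
    ⟨D.one, D.one, ⟨D.one_mem', D.one_mem', fun _ _ => Iff.rfl⟩, c, hc, ?_⟩
  rw [D.inv_mul' _ D.one_mem', D.one_mul' _ (D.qTupleSet_subset_carrier w k hc)]

/-- A finite part of the data saying that two elements lie in the group and have the same type
over a tuple indexed by `α`. -/
abbrev Approx (α : Type u) : Type u := Finset (TupleFormula L α) × Finset D.pStar

variable {D}

/-- The finite part `t` of the statement that `y` and `z` are elements of the group of the same
type over `w`. -/
def Agree (t : D.Approx α) (w : α → M) (y z : M) : Prop :=
  (∀ f ∈ t.2, (f.1.Realize fun _ => y) ∧ f.1.Realize fun _ => z) ∧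
    ∀ j ∈ t.1, (j.Realize w y ↔ j.Realize w z)

/-- Quotients of elements which agree on `t`. -/
def ApproxQuot (t : D.Approx α) (w : α → M) (x : M) : Prop :=
  ∃ y z, Agree t w y z ∧ D.mul (D.inv y) z = x

/-- Products of `k` quotients of elements which agree on `t`. -/
def ApproxPow (t : D.Approx α) (w : α → M) : ℕ → M → Prop
  | 0, x => x = D.one
  | k + 1, x => ∃ y z, (ApproxQuot t w y ∧ ApproxPow t w k z) ∧ D.mul y z = x

theorem SameTypeOver.agree {w : α → M} {y z : M} (h : D.SameTypeOver w y z) (t : D.Approx α) :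
    Agree t w y z :=
  ⟨fun f _ => ⟨h.1 f.1 f.2, h.2.1 f.1 f.2⟩, fun j _ =>
    h.2.2 ⟨j.1, j.2.1, fun i => w (j.2.2 i)⟩ fun _ => mem_range_self _⟩

theorem sameTypeOver_of_forall_agree {w : α → M} {y z : M}
    (h : ∀ t : D.Approx α, Agree t w y z) : D.SameTypeOver w y z := by
  refine ⟨fun f hf => ?_, fun f hf => ?_, fun f hf => ?_⟩
  · exact ((h (∅, {⟨f, hf⟩})).1 _ (Finset.mem_singleton_self _)).1
  · exact ((h (∅, {⟨f, hf⟩})).1 _ (Finset.mem_singleton_self _)).2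
  · choose vs hvs using hf
    have key : ∀ x, TupleFormula.Realize (⟨f.m, f.toFormula, vs⟩ : TupleFormula L α) w x ↔
        f.Realize fun _ => x := fun x => by
      simp only [TupleFormula.Realize, ParamFormula.Realize, hvs]
    rw [← key, ← key]
    exact (h ({⟨f.m, f.toFormula, vs⟩}, ∅)).2 _ (Finset.mem_singleton_self _)

theorem Agree.mono {s t : D.Approx α} (hst : s ≤ t) {w : α → M} {y z : M} (h : Agree t w y z) :
    Agree s w y z :=
  ⟨fun f hf => h.1 f (hst.2 hf), fun j hj => h.2 j (hst.1 hj)⟩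

theorem ApproxQuot.mono {s t : D.Approx α} (hst : s ≤ t) {w : α → M} {x : M}
    (h : ApproxQuot t w x) : ApproxQuot s w x := by
  obtain ⟨y, z, hyz, rfl⟩ := h
  exact ⟨y, z, hyz.mono hst, rfl⟩

theorem ApproxPow.mono {s t : D.Approx α} (hst : s ≤ t) {w : α → M} {k : ℕ} {x : M}
    (h : ApproxPow t w k x) : ApproxPow s w k x := by
  induction k generalizing x with
  | zero => exact h
  | succ k ih =>
    obtain ⟨y, z, ⟨hy, hz⟩, rfl⟩ := h
    exact ⟨y, z, ⟨hy.mono hst, ih hz⟩, rfl⟩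

theorem approxPow_of_mem_qTupleSet {w : α → M} {k : ℕ} {c : M} (hc : c ∈ D.qTupleSet w k)
    (t : D.Approx α) : ApproxPow t w k c := by
  induction k generalizing c with
  | zero => exact D.mem_qTupleSet_zero.1 hc
  | succ k ih =>
    obtain ⟨y, z, h, c', hc', rfl⟩ := D.mem_qTupleSet_succ.1 hc
    exact ⟨_, c', ⟨⟨y, z, h.agree t, rfl⟩, ih hc'⟩, rfl⟩

variable (D) in
theorem definablePred_mul (i j k : β) :
    DefinablePred L D.AStar fun v : β → M => D.mul (v i) (v j) = v k := by
  obtain ⟨φ, hφ, h⟩ := D.mul_definable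
  have := DefinablePred.of_paramFormula (L := L) hφ ![i, j, k]
  convert this with v
  rw [← h]
  refine iff_of_eq (congrArg _ (funext fun l => ?_))
  fin_cases l <;> rfl

variable (D) in
theorem definablePred_inv_mul (i j k : β) :
    DefinablePred L D.AStar fun v : β → M => D.mul (D.inv (v i)) (v j) = v k := by
  have : DefinablePred L D.AStar fun v : β → M =>
      ∃ u, D.inv (v i) = u ∧ D.mul u (v j) = v k := by
    refine .ex (.and ?_ (D.definablePred_mul none (some j) (some k)))
    obtain ⟨φ, hφ, h⟩ := D.inv_definable
    have := DefinablePred.of_paramFormula (L := L) hφ ![some i, none]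
    convert this with v
    rw [← h]
    refine iff_of_eq (congrArg _ (funext fun l => ?_))
    fin_cases l <;> rfl
  simpa using this

variable (D) in
theorem definablePred_one (i : β) :
    DefinablePred L D.AStar fun v : β → M => v i = D.one := by
  obtain ⟨φ, hφ, h⟩ := D.one_definable
  have := DefinablePred.of_paramFormula (L := L) hφ ![i]
  convert this with v
  rw [← h]
  refine iff_of_eq (congrArg _ (funext fun l => ?_))
  fin_cases l; rfl

theorem definablePred_agree (t : D.Approx α) (e : α → β) (i j : β) :
    DefinablePred L D.AStar fun v : β → M => Agree t (fun p => v (e p)) (v i) (v j) := by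
  have hj : ∀ (j : TupleFormula L α) (i : β),
      DefinablePred L D.AStar fun v : β → M => j.Realize (fun p => v (e p)) (v i) := by
    intro j i
    have := DefinablePred.of_formula (M := M) (A := D.AStar) j.2.1
      (Sum.elim (fun _ => i) fun l => e (j.2.2 l))
    convert this with v
    refine iff_of_eq (congrArg _ (funext ?_))
    rintro (l | l) <;> rfl
  exact .and
    (.finset_forall _ fun f _ => .and (.of_paramFormula (D.pStar_over f.1 f.2) fun _ => i)
      (.of_paramFormula (D.pStar_over f.1 f.2) fun _ => j))
    (.finset_forall _ fun f _ => .iff (hj f i) (hj f j))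

theorem definablePred_approxQuot (t : D.Approx α) (e : α → β) (i : β) :
    DefinablePred L D.AStar fun v : β → M => ApproxQuot t (fun p => v (e p)) (v i) :=
  .ex (.ex (.and (definablePred_agree t (fun p => some (some (e p))) (some none) none)
    (D.definablePred_inv_mul (some none) none (some (some i)))))

theorem definablePred_approxPow (t : D.Approx α) (k : ℕ) (e : α → β) (i : β) :
    DefinablePred L D.AStar fun v : β → M => ApproxPow t (fun p => v (e p)) k (v i) := by
  induction k generalizing β with
  | zero => exact D.definablePred_one i
  | succ k ih =>
    exact .ex (.ex (.and
      (.and (definablePred_approxQuot t (fun p => some (some (e p))) (some none))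
        (ih (fun p => some (some (e p))) none))
      (D.definablePred_mul (some none) none (some (some i)))))

section Limit

variable {κ : Cardinal.{u}} (hκ : ℵ₀ < κ) (hsat : Saturated L M κ) (hA : #D.AStar < κ)
  (hα : #α < κ) {w : α → M}

include hκ hsat hA hα

theorem exists_sameTypeOver_of_approxQuot {x : M} (h : ∀ t : D.Approx α, ApproxQuot t w x) :
    ∃ y z, D.SameTypeOver w y z ∧ D.mul (D.inv y) z = x := by
  classical
  obtain ⟨y, z, hyz⟩ := hsat.exists_pair hκ hA (P := Option α)
    (by rw [mk_option]; exact add_lt_of_lt hκ.le hα (one_lt_aleph0.trans hκ))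
    (fun o => o.elim x w) (I := D.Approx α)
    (X := fun t v y z => Agree t (fun p => v (some p)) y z ∧ D.mul (D.inv y) z = v none)
    (fun t => .and
      (definablePred_agree t (fun p => some (some (some p))) (some none) none)
      (D.definablePred_inv_mul (some none) none (some (some none))))
    (fun s t hst v y z hyz => ⟨hyz.1.mono hst, hyz.2⟩) h
  exact ⟨y, z, sameTypeOver_of_forall_agree fun t => (hyz t).1, (hyz (∅, ∅)).2⟩

theorem mem_qTupleSet_of_approxPow {k : ℕ} {c : M} (h : ∀ t : D.Approx α, ApproxPow t w k c) :
    c ∈ D.qTupleSet w k := by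
  classical
  induction k generalizing c with
  | zero => exact D.mem_qTupleSet_zero.2 (h (∅, ∅))
  | succ k ih =>
    obtain ⟨x, c', hx⟩ := hsat.exists_pair hκ hA (P := Option α)
      (by rw [mk_option]; exact add_lt_of_lt hκ.le hα (one_lt_aleph0.trans hκ))
      (fun o => o.elim c w) (I := D.Approx α)
      (X := fun t v x z => (ApproxQuot t (fun p => v (some p)) x ∧
        ApproxPow t (fun p => v (some p)) k z) ∧ D.mul x z = v none)
      (fun t => .and
        (.and (definablePred_approxQuot t (fun p => some (some (some p))) (some none))
          (definablePred_approxPow t k (fun p => some (some (some p))) none))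
        (D.definablePred_mul (some none) none (some (some none))))
      (fun s t hst v x z hxz => ⟨⟨hxz.1.1.mono hst, hxz.1.2.mono hst⟩, hxz.2⟩) h
    obtain ⟨y, z, hyz, rfl⟩ :=
      exists_sameTypeOver_of_approxQuot hκ hsat hA hα fun t => (hx t).1.1
    exact D.mem_qTupleSet_succ.2 ⟨y, z, hyz, c', ih fun t => (hx t).1.2, (hx (∅, ∅)).2.symm⟩

/-- Failure of membership in `q^{k+2}` is witnessed by a finite approximation. -/
theorem exists_approx_of_notMem (habel : D.IsAbelian) {k : ℕ} {c : M} (hc : c ∈ D.carrier)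
    (h : c ∉ D.qTupleSet w (k + 2)) :
    ∃ t : D.Approx α, ∀ x x', ApproxQuot t w x → ApproxPow t w (k + 1) x' → D.mul c x ≠ x' := by
  classical
  by_contra! H
  obtain ⟨x, x', hx⟩ := hsat.exists_pair hκ hA (P := Option α)
    (by rw [mk_option]; exact add_lt_of_lt hκ.le hα (one_lt_aleph0.trans hκ))
    (fun o => o.elim c w) (I := D.Approx α)
    (X := fun t v x z => (ApproxQuot t (fun p => v (some p)) x ∧
      ApproxPow t (fun p => v (some p)) (k + 1) z) ∧ D.mul (v none) x = z)
    (fun t => .and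
      (.and (definablePred_approxQuot t (fun p => some (some (some p))) (some none))
        (definablePred_approxPow t (k + 1) (fun p => some (some (some p))) none))
      (D.definablePred_mul (some (some none)) (some none) none))
    (fun s t hst v x z hxz => ⟨⟨hxz.1.1.mono hst, hxz.1.2.mono hst⟩, hxz.2⟩)
    (fun t => by
      obtain ⟨x, x', h1, h2, h3⟩ := H t
      exact ⟨x, x', ⟨h1, h2⟩, h3⟩)
  obtain ⟨y, z, hyz, rfl⟩ := exists_sameTypeOver_of_approxQuot hκ hsat hA hα fun t => (hx t).1.1
  have hx' := mem_qTupleSet_of_approxPow hκ hsat hA hα fun t => (hx t).1.2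
  refine h (D.mem_qTupleSet_succ.2
    ⟨z, y, ⟨hyz.2.1, hyz.1, fun f hf => (hyz.2.2 f hf).symm⟩, x', hx', ?_⟩)
  have e : D.mul c (D.mul (D.inv y) z) = x' := (hx (∅, ∅)).2
  let := D.commGroup habel
  have key : ∀ a b d : D.carrier, a = b⁻¹ * d * (a * (d⁻¹ * b)) := fun a b d => by
    rw [mul_comm a, ← mul_assoc]; group
  rw [← e]
  exact congrArg Subtype.val (key ⟨c, hc⟩ ⟨z, hyz.2.1⟩ ⟨y, hyz.1⟩)

end Limit

/-- In a dependent theory, no sequence of elements has each `c j` in `q^k` over the earlier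
tuples while each `c i` is far from `q^{k+1}` over its own tuple, uniformly in `i`. -/
theorem not_exists_sequence {κ : Cardinal.{u}} (hκ : ℵ₀ < κ) (hsat : Saturated L M κ)
    (hdep : IsDependent L M) (habel : D.IsAbelian) (k : ℕ) (t : D.Approx α) (c : ℕ → M)
    (w : ℕ → α → M) (hc : ∀ i, c i ∈ D.carrier)
    (hlt : ∀ i j, i < j → c j ∈ D.qTupleSet (w i) k) :
    ∃ i x x', ApproxQuot t (w i) x ∧ ApproxPow t (w i) (k + 1) x' ∧ D.mul (c i) x = x' := by
  classical
  by_contra! hfar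
  let := D.commGroup habel
  obtain ⟨n, hn⟩ := hdep.not_patterns hκ hsat
    (definablePred_approxQuot t (some : α → Option α) none)
  let cls : ℕ → D.carrier → t.1 → Prop := fun i y j => j.1.Realize (w i) y
  have hagree : ∀ i (y z : D.carrier), cls i y = cls i z → Agree t (w i) y z := fun i y z h =>
    ⟨fun f _ => ⟨y.2 f.1 f.2, z.2 f.1 f.2⟩, fun j hj => iff_of_eq (congrFun h ⟨j, hj⟩)⟩
  obtain ⟨h, hh⟩ := exists_patterns cls (fun i => {x : D.carrier | ApproxQuot t (w i) x})
    (fun i => ⟨c i, hc i⟩) (fun i y z hyz => ⟨y, z, hagree i y z hyz, rfl⟩)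
    (fun i j hij y z hyz hmem => by
      refine hfar i _ _ hmem ⟨_, c j, ⟨⟨y, z, hagree i y z hyz, rfl⟩,
        approxPow_of_mem_qTupleSet (hlt i j hij) t⟩, rfl⟩ ?_
      have key : ∀ a b d : D.carrier, a * (a⁻¹ * b * d) = d * b := fun a b d => by
        rw [mul_assoc, mul_inv_cancel_left, mul_comm]
      exact congrArg Subtype.val (key ⟨c i, hc i⟩ ⟨c j, hc j⟩ (y⁻¹ * z))) n
  obtain ⟨u, hu, hun⟩ := hn fun m => w (h m)
  obtain ⟨b, hb⟩ := hh (Finset.range n \ u) Finset.sdiff_subset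
  obtain ⟨m, hm, hmb⟩ := hun b
  refine hmb ((hb m hm).trans ?_)
  simp [hm]

/-- For each approximation there are finitely many tuples such that no element of the
intersection of their `q^k` is far from `q^{k+1}` over any tuple. -/
theorem exists_list {κ : Cardinal.{u}} (hκ : ℵ₀ < κ) (hsat : Saturated L M κ)
    (hdep : IsDependent L M) (habel : D.IsAbelian) (k : ℕ) (t : D.Approx α) :
    ∃ l : List (α → M), ∀ c ∈ D.carrier, (∀ b ∈ l, c ∈ D.qTupleSet b k) → ∀ a : α → M,
      ∃ x x', ApproxQuot t a x ∧ ApproxPow t a (k + 1) x' ∧ D.mul c x = x' := by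
  by_contra! H
  choose c hc hl a ha using H
  let S : ℕ → List (α → M) := fun n => n.rec [] fun _ l => a l :: l
  have hS : ∀ i j, i < j → a (S i) ∈ S j := by
    intro i j hij
    induction j, hij using Nat.le_induction with
    | base => exact List.mem_cons_self
    | succ j _ ih => exact List.mem_cons_of_mem _ ih
  obtain ⟨i, x, x', h1, h2, h3⟩ := not_exists_sequence hκ hsat hdep habel k t
    (fun n => c (S n)) (fun n => a (S n)) (fun n => hc _) fun i j hij => hl _ _ (hS i j hij)
  exact ha _ x x' h1 h2 h3

end DefGroup

/-- The Main Claim 1.9 of [Sh:886] (with Remark 1.10): if `T` is dependent and `G` is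
abelian, then for `k(1) + 2 < k(2)` and `α < κ̄` there are `λ < κ̄` (in fact
`λ = 2^{2^{|α|+|T|+|A*|}}` suffices) and tuples `ā_ε ∈ ^α𝔠` (`ε < λ`), chosen independently
of `k(1), k(2)`, such that for every `ā ∈ ^α𝔠` with `A* ⊆ Rang(ā)` we have
`⋂_{ε<λ} q^{k(1)}_{ā_ε}(𝔠) ⊆ q^{k(2)}_{ā}(𝔠)`. -/
theorem mainClaim_h20
    {L : FirstOrder.Language.{u, u}} {M : Type u} [L.Structure M]
    (κbar : Cardinal.{u}) (hκinacc : κbar.IsInaccessible) (hκT : theoryCard L < κbar)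
    (hκsat : Saturated L M κbar)
    (hdep : IsDependent L M)
    (D : DefGroup L M) (hAκ : #(D.AStar) < κbar) (habel : D.IsAbelian)
    (α : Type u) (hα : #α < κbar) :
    ∃ (ι : Type u) (aseq : ι → α → M),
      #ι ≤ (2 : Cardinal.{u}) ^ ((2 : Cardinal.{u}) ^ (#α ⊔ theoryCard L ⊔ #(D.AStar))) ∧ #ι < κbar ∧
      ∀ k1 k2 : ℕ, k1 + 2 < k2 →
        ∀ a : α → M, D.AStar ⊆ Set.range a →
          (⋂ ε : ι, D.qTupleSet (aseq ε) k1) ⊆ D.qTupleSet a k2 := by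
  classical
  have hκ : ℵ₀ < κbar := hκinacc.aleph0_lt
  choose l hl using fun x : ℕ × D.Approx α =>
    DefGroup.exists_list hκ hκsat hdep habel x.1 x.2
  let μ := #α ⊔ theoryCard L ⊔ #(D.AStar)
  have hμ : ℵ₀ ≤ μ := aleph0_le_theoryCard.trans (le_sup_right.trans le_sup_left)
  have hμκ : μ < κbar := max_lt (max_lt hα hκT) hAκ
  let ι := Option ((x : ULift.{u} ℕ × D.Approx α) × ULift.{u} (Fin (l (x.1.down, x.2)).length))
  have hι : #ι ≤ μ := by
    rw [mk_option]
    refine add_le_of_le hμ (mk_sigma_le hμ ?_ fun x => ?_) (one_le_aleph0.trans hμ)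
    · rw [mk_prod, lift_id, lift_id]
      refine mul_le_of_le hμ (by simpa using hμ) ?_
      rw [mk_prod, lift_id, lift_id]
      exact mul_le_of_le hμ
        (mk_finset_le hμ ((TupleFormula.mk_le α).trans le_sup_left))
        (mk_finset_le hμ (D.mk_pStar_le.trans
          (sup_le le_sup_right (le_sup_right.trans le_sup_left))))
    · exact (lt_aleph0_of_finite _).le.trans hμ
  refine ⟨ι, fun o => o.elim (fun _ => D.one) fun x => (l (x.1.1.down, x.1.2)).get x.2.down,
    hι.trans ((cantor μ).le.trans (cantor _).le), hι.trans_lt hμκ, fun k1 k2 hk a _ c hc => ?_⟩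
  rw [mem_iInter] at hc
  have hcG : c ∈ D.carrier := D.qTupleSet_subset_carrier _ _ (hc none)
  refine D.qTupleSet_mono a hk.le (by_contra fun hca => ?_)
  obtain ⟨t, ht⟩ := DefGroup.exists_approx_of_notMem hκ hκsat hAκ hα habel hcG hca
  obtain ⟨x, x', h1, h2, h3⟩ := hl (k1, t) c hcG (fun b hb => by
    obtain ⟨i, rfl⟩ := List.get_of_mem hb
    exact hc (some ⟨(⟨k1⟩, t), ⟨i⟩⟩)) a
  exact ht x x' h1 h2 h3

end Paper886
end

section
/- For a complete first-order theory T and k ≥ 1, the following are equivalent: (i) there is a k-independent formula φ(x, ȳ_0, …, ȳ_{k-1}) with a single object variable x; (ii) T is k-independent, i.e. for some m ≥ 1 there is a k-independent formula φ(x̄_m, ȳ_0, …, ȳ_{k-1}) with x̄_m = ⟨x_ℓ : ℓ < m⟩; (iii) for every m ≥ 1 there is a k-independent formula φ(x̄_m, ȳ_0, …, ȳ_{k-1}). -/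
open FirstOrder Cardinal Set

universe u

namespace Paper886

variable {L : FirstOrder.Language.{u, u}} {M : Type u} [L.Structure M]

/-- A dense subset of a suitable `k`-dimensional box contains a `k`-dimensional cube of prescribed
side `d` (the Kővári–Sós–Turán–Erdős theorem for `k`-partite `k`-uniform hypergraphs). -/
theorem exists_box_of_dense (d : ℕ) : ∀ k r : ℕ, ∃ N : Fin k → ℕ, (∀ ℓ, 0 < N ℓ) ∧
    ∀ S ⊆ Fintype.piFinset (fun ℓ => Finset.range (N ℓ)),
      (Fintype.piFinset fun ℓ => Finset.range (N ℓ)).card ≤ r * S.card →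
        ∃ e : Fin k → Fin d → ℕ, (∀ ℓ, Function.Injective (e ℓ)) ∧
          ∀ η : Fin k → Fin d, (fun ℓ => e ℓ (η ℓ)) ∈ S := by
  intro k
  induction k with
  | zero =>
    intro r
    refine ⟨Fin.elim0, fun ℓ => ℓ.elim0, fun S _ hS => ?_⟩
    have hne : S.Nonempty := by
      rw [Finset.nonempty_iff_ne_empty]
      rintro rfl
      simp at hS
    obtain ⟨x, hx⟩ := hne
    refine ⟨fun ℓ => ℓ.elim0, fun ℓ => ℓ.elim0, fun η => ?_⟩
    rwa [Subsingleton.elim (fun ℓ : Fin 0 => _) x]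
  | succ k ih =>
    intro r
    set m := 2 * (r * d + 1) with hm
    obtain ⟨N, hN, hbox⟩ := ih (2 * r * 2 ^ m)
    refine ⟨Fin.cons m N, fun ℓ => ?_, fun S hS hcard => ?_⟩
    · refine Fin.cases ?_ ?_ ℓ
      · simp [hm]
      · simpa using hN
    set X := Fintype.piFinset fun ℓ => Finset.range (N ℓ) with hX
    have hXpos : 0 < X.card := by
      rw [hX, Fintype.card_piFinset]
      exact Finset.prod_pos fun ℓ _ => by simpa using hN ℓ
    have hcardX : (Fintype.piFinset fun ℓ => Finset.range ((Fin.cons m N : Fin (k + 1) → ℕ) ℓ)).card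
        = m * X.card := by
      simp [hX, Fintype.card_piFinset, Fin.prod_univ_succ]
    rw [hcardX] at hcard
    let F : (Fin k → ℕ) → Finset ℕ := fun x =>
      (Finset.range m).filter fun j => (Fin.cons j x : Fin (k + 1) → ℕ) ∈ S
    have hFm : ∀ x, (F x).card ≤ m := fun x =>
      (Finset.card_filter_le _ _).trans (Finset.card_range m).le
    set G := X.filter fun x => d ≤ (F x).card with hG
    have hSle : S.card ≤ d * X.card + m * G.card := by
      have hsub : S ⊆ X.biUnion fun x =>
          (F x).image fun j => (Fin.cons j x : Fin (k + 1) → ℕ) := by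
        intro z hz
        have hz' := hS hz
        simp only [Fintype.mem_piFinset, Finset.mem_range] at hz'
        simp only [Finset.mem_biUnion, Finset.mem_image, F, Finset.mem_filter, Finset.mem_range]
        refine ⟨Fin.tail z, ?_, z 0, ⟨?_, ?_⟩, Fin.cons_self_tail z⟩
        · simp only [hX, Fintype.mem_piFinset, Finset.mem_range]
          intro ℓ
          simpa [Fin.tail] using hz' ℓ.succ
        · simpa using hz' 0
        · rwa [Fin.cons_self_tail]
      calc S.card ≤ _ := Finset.card_le_card hsub
        _ ≤ ∑ x ∈ X, ((F x).image fun j => (Fin.cons j x : Fin (k + 1) → ℕ)).card :=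
          Finset.card_biUnion_le
        _ ≤ ∑ x ∈ X, (d + if d ≤ (F x).card then m else 0) := by
          refine Finset.sum_le_sum fun x _ => Finset.card_image_le.trans ?_
          split_ifs with h
          · exact (hFm x).trans (by omega)
          · omega
        _ = d * X.card + m * G.card := by
          rw [Finset.sum_add_distrib, ← Finset.sum_filter]
          simp [hG, mul_comm]
    have hGX : X.card ≤ 2 * r * G.card := by
      have h1 : m * X.card ≤ r * (d * X.card + m * G.card) :=
        hcard.trans (Nat.mul_le_mul_left _ hSle)
      have h2 : m * X.card ≤ m * (2 * r * G.card) := by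
        have : 2 * (r * d) * X.card ≤ m * X.card := Nat.mul_le_mul_right _ (by omega)
        nlinarith
      exact Nat.le_of_mul_le_mul_left h2 (by omega)
    obtain ⟨D, -, hD⟩ : ∃ D ∈ (Finset.range m).powerset,
        G.card ≤ 2 ^ m * (G.filter fun x => F x = D).card := by
      by_contra! hlt
      have h1 := Finset.card_eq_sum_card_fiberwise (s := G) (f := F)
        (t := (Finset.range m).powerset)
        (fun x _ => Finset.mem_coe.2 (Finset.mem_powerset.2 (Finset.filter_subset _ _)))
      have h2 : ∑ D ∈ (Finset.range m).powerset, 2 ^ m * (G.filter fun x => F x = D).card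
          < ∑ _D ∈ (Finset.range m).powerset, G.card :=
        Finset.sum_lt_sum_of_nonempty ⟨∅, by simp⟩ hlt
      rw [← Finset.mul_sum, ← h1] at h2
      simp at h2
    have hfib : X.card ≤ 2 * r * 2 ^ m * (G.filter fun x => F x = D).card := by
      calc X.card ≤ 2 * r * G.card := hGX
        _ ≤ 2 * r * (2 ^ m * (G.filter fun x => F x = D).card) := Nat.mul_le_mul_left _ hD
        _ = _ := by ring
    have hDcard : d ≤ D.card := by
      have hne : (G.filter fun x => F x = D).Nonempty := by
        rw [← Finset.card_pos]
        exact Nat.pos_of_ne_zero fun h => by rw [h] at hfib; omega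
      obtain ⟨x, hx⟩ := hne
      rw [Finset.mem_filter, hG, Finset.mem_filter] at hx
      rw [← hx.2]
      exact hx.1.2
    obtain ⟨e, he, heS⟩ := hbox _
      ((Finset.filter_subset _ _).trans (Finset.filter_subset _ _)) hfib
    refine ⟨Fin.cons (D.orderEmbOfCardLe hDcard) e, fun ℓ => ?_, fun η => ?_⟩
    · refine Fin.cases ?_ ?_ ℓ
      · exact (D.orderEmbOfCardLe hDcard).injective
      · simpa using he
    · have hx := heS (Fin.tail η)
      have hmem := D.orderEmbOfCardLe_mem hDcard (η 0)
      rw [Finset.mem_filter] at hx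
      have hmemF := (Finset.ext_iff.1 hx.2 _).2 hmem
      rw [Finset.mem_filter] at hmemF
      convert hmemF.2 using 1
      funext ℓ
      refine Fin.cases ?_ (fun i => ?_) ℓ <;> simp [Fin.tail]

/-- Few subsets of a finite set are sparse. -/
theorem exists_card_sparse_le {c : ℝ} (hc : 1 < c) : ∃ r : ℕ, ∀ {α : Type} (Y : Finset α)
    (𝒮 : Finset (Finset α)), (∀ S ∈ 𝒮, S ⊆ Y ∧ r * S.card ≤ Y.card) →
      (𝒮.card : ℝ) ≤ (c * c) ^ Y.card := by
  obtain ⟨y, hy0, hyc⟩ : ∃ y : ℝ, 0 < y ∧ y + 1 = c := ⟨c - 1, by linarith, by ring⟩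
  obtain ⟨r, hr⟩ := pow_unbounded_of_one_lt y⁻¹ hc
  refine ⟨r, fun {α} Y 𝒮 h𝒮 => ?_⟩
  have hsum : ∑ S ∈ 𝒮, y ^ S.card ≤ c ^ Y.card := by
    rw [← hyc, ← Finset.sum_pow_mul_eq_add_pow]
    simp only [one_pow, mul_one]
    exact Finset.sum_le_sum_of_subset_of_nonneg
      (fun S hS => Finset.mem_powerset.2 (h𝒮 S hS).1) fun _ _ _ => by positivity
  have hterm : ∀ S ∈ 𝒮, (1 : ℝ) ≤ c ^ Y.card * y ^ S.card := by
    intro S hS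
    calc (1 : ℝ) = (y⁻¹) ^ S.card * y ^ S.card := by
          rw [← mul_pow, inv_mul_cancel₀ hy0.ne', one_pow]
      _ ≤ (c ^ r) ^ S.card * y ^ S.card := by gcongr
      _ = c ^ (r * S.card) * y ^ S.card := by rw [pow_mul]
      _ ≤ c ^ Y.card * y ^ S.card := by
          gcongr
          · exact hc.le
          · exact (h𝒮 S hS).2
  calc (𝒮.card : ℝ) = ∑ S ∈ 𝒮, (1 : ℝ) := by simp
    _ ≤ ∑ S ∈ 𝒮, c ^ Y.card * y ^ S.card := Finset.sum_le_sum hterm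
    _ = c ^ Y.card * ∑ S ∈ 𝒮, y ^ S.card := by rw [Finset.mul_sum]
    _ ≤ c ^ Y.card * c ^ Y.card := by gcongr
    _ = (c * c) ^ Y.card := by rw [mul_pow]

/-- If every function `R : X → Q` is a selector of one of the families `G b` of proper subsets
of `Q`, then for some `p : Q` the sets `{x | p ∈ G b x}` shatter a dense subset of `X`. -/
theorem exists_dense_shattered (Q : Type) [Finite Q] [Nonempty Q] : ∃ r : ℕ, ∀ {α : Type} (X : Finset α),
    X.Nonempty → ∀ {B : Type*} (G : B → α → Set Q), (∀ b x, G b x ≠ Set.univ) →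
      (∀ R : α → Q, ∃ b, ∀ x ∈ X, R x ∈ G b x) →
        ∃ p : Q, ∃ S ⊆ X, X.card ≤ r * S.card ∧
          ∀ T ⊆ S, ∃ b, ∀ x ∈ S, p ∈ G b x ↔ x ∈ T := by
  classical
  have := Fintype.ofFinite Q
  set q := Fintype.card Q with hq
  obtain ⟨c, hc1, hc⟩ : ∃ c : ℝ, 1 < c ∧ (c * c) ^ q * (q - 1) < q := by
    have hcont : ContinuousAt (fun c : ℝ => (c * c) ^ q * (q - 1)) 1 := by fun_prop
    have hev := hcont.eventually_lt (continuousAt_const (y := (q : ℝ))) (by simp)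
    obtain ⟨c, hc, hc1⟩ := ((hev.filter_mono nhdsWithin_le_nhds).and
      (self_mem_nhdsWithin (s := Set.Ioi (1 : ℝ)))).exists
    exact ⟨c, hc1, hc⟩
  obtain ⟨r, hr⟩ := exists_card_sparse_le hc1
  refine ⟨r, fun {α} X hX {B} G hG hcov => ?_⟩
  let Gr : B → Finset (α × Q) := fun b => (X ×ˢ Finset.univ).filter fun z => z.2 ∈ G b z.1
  have hcov' : ∀ R : X → Q, ∃ b, ∀ x : X, R x ∈ G b x := by
    intro R
    obtain ⟨x₀, hx₀⟩ := hX
    obtain ⟨b, hb⟩ := hcov fun x => if h : x ∈ X then R ⟨x, h⟩ else R ⟨x₀, hx₀⟩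
    exact ⟨b, fun x => by simpa using hb x x.2⟩
  choose β hβ using hcov'
  let 𝓕 : Finset (Finset (α × Q)) := Finset.univ.image fun R => Gr (β R)
  have hcount : q ^ X.card ≤ 𝓕.card * (q - 1) ^ X.card := by
    have huniv : (Finset.univ : Finset (X → Q)) ⊆ 𝓕.biUnion fun F =>
        Fintype.piFinset fun x : X => Finset.univ.filter fun p => (x.1, p) ∈ F := by
      intro R _
      simp only [𝓕, Finset.mem_biUnion, Finset.mem_image, Finset.mem_univ, true_and,
        exists_exists_eq_and, Fintype.mem_piFinset, Finset.mem_filter]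
      exact ⟨R, fun x => by simpa [Gr] using hβ R x⟩
    have hle := (Finset.card_le_card huniv).trans
      (Finset.card_biUnion_le_card_mul 𝓕 _ ((q - 1) ^ X.card) ?_)
    · simpa [hq] using hle
    · intro F hF
      obtain ⟨R, -, rfl⟩ := Finset.mem_image.1 hF
      rw [Fintype.card_piFinset]
      calc _ ≤ ∏ _x : X, (q - 1) := Finset.prod_le_prod' fun x _ => ?_
        _ = _ := by simp
      obtain ⟨p, hp⟩ := (Set.ne_univ_iff_exists_notMem _).1 (hG (β R) x)
      rw [hq, ← Finset.card_univ, Nat.le_sub_one_iff_lt (Finset.card_pos.2 ⟨p, by simp⟩)]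
      refine Finset.card_lt_card ((Finset.ssubset_univ_iff).2 fun h => hp ?_)
      have := h ▸ Finset.mem_univ p
      simpa [Gr] using this
  have hYcard : (X ×ˢ (Finset.univ : Finset Q)).card = q * X.card := by
    rw [Finset.card_product, Finset.card_univ, mul_comm]
  obtain ⟨S, hSsh, hS⟩ : ∃ S ∈ 𝓕.shatterer, q * X.card < r * S.card := by
    by_contra! hno
    have hbd := hr (X ×ˢ (Finset.univ : Finset Q)) 𝓕.shatterer fun S hS => ⟨?_, ?_⟩
    · have h1 : (𝓕.card : ℝ) ≤ ((c * c) ^ q) ^ X.card := by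
        rw [← pow_mul, ← hYcard]
        exact (Nat.cast_le.2 𝓕.card_le_card_shatterer).trans hbd
      have hqpos : 0 < q := Fintype.card_pos
      have h2 : (q : ℝ) ^ X.card ≤ ((c * c) ^ q * (q - 1)) ^ X.card := by
        calc (q : ℝ) ^ X.card ≤ 𝓕.card * (q - 1) ^ X.card := by
              have := (Nat.cast_le (α := ℝ)).2 hcount
              rwa [Nat.cast_mul, Nat.cast_pow, Nat.cast_pow, Nat.cast_sub hqpos,
                Nat.cast_one] at this
          _ ≤ ((c * c) ^ q) ^ X.card * (q - 1) ^ X.card := by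
              have : (1 : ℝ) ≤ q := by exact_mod_cast hqpos
              have : (0 : ℝ) ≤ q - 1 := by linarith
              gcongr
          _ = _ := (mul_pow _ _ _).symm
      have : (1 : ℝ) ≤ q := by exact_mod_cast hqpos
      have h0 : (0 : ℝ) ≤ q - 1 := by linarith
      exact absurd h2 (not_le.2 (pow_lt_pow_left₀ hc (by positivity) hX.card_pos.ne'))
    · obtain ⟨F, hF, hSF⟩ := (Finset.mem_shatterer.1 hS).exists_superset
      obtain ⟨R, -, rfl⟩ := Finset.mem_image.1 hF
      exact hSF.trans (Finset.filter_subset _ _)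
    · rw [hYcard]
      exact hno S hS
  obtain ⟨F, hF, hSF⟩ := (Finset.mem_shatterer.1 hSsh).exists_superset
  obtain ⟨R, -, rfl⟩ := Finset.mem_image.1 hF
  have hSX : ∀ z ∈ S, z.1 ∈ X := fun z hz => by
    have := hSF hz
    simp only [Gr, Finset.mem_filter, Finset.mem_product] at this
    exact this.1.1
  obtain ⟨p, hp⟩ : ∃ p : Q, X.card ≤ r * (X.filter fun x => (x, p) ∈ S).card := by
    by_contra! hno
    have h1 := Finset.card_eq_sum_card_fiberwise (s := S) (f := Prod.snd) (t := Finset.univ)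
      (fun _ _ => by simp)
    have h2 : ∀ p : Q, (S.filter fun z => z.2 = p).card
        ≤ (X.filter fun x => (x, p) ∈ S).card := by
      intro p
      refine Finset.card_le_card_of_injOn Prod.fst ?_ ?_
      · rintro ⟨x, p'⟩ hz
        simp only [Finset.coe_filter, Set.mem_ofPred_eq] at hz ⊢
        obtain ⟨hz, rfl⟩ := hz
        exact ⟨hSX _ hz, hz⟩
      · rintro ⟨x, p'⟩ hz ⟨x', p''⟩ hz' h
        simp only [Finset.coe_filter, Set.mem_ofPred_eq] at hz hz' h
        rw [h, hz.2, hz'.2]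
    have h3 : r * S.card ≤ ∑ _p : Q, X.card := by
      rw [h1, Finset.mul_sum]
      exact Finset.sum_le_sum fun p _ => (Nat.mul_le_mul_left _ (h2 p)).trans (hno p).le
    rw [Finset.sum_const, Finset.card_univ, smul_eq_mul] at h3
    exact absurd h3 (not_le.2 hS)
  refine ⟨p, X.filter fun x => (x, p) ∈ S, Finset.filter_subset _ _, hp, fun T hT => ?_⟩
  obtain ⟨F, hF, hFT⟩ := Finset.mem_shatterer.1 hSsh
    (t := S.filter fun z => z.1 ∈ T) (Finset.filter_subset _ _)
  obtain ⟨R', -, rfl⟩ := Finset.mem_image.1 hF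
  refine ⟨β R', fun x hx => ?_⟩
  rw [Finset.mem_filter] at hx
  have h := Finset.ext_iff.1 hFT (x, p)
  simpa [Gr, hx.1, hx.2] using h

/-- The relation `S` (finitely) shatters a `k`-dimensional grid indexed by `ι`. -/
def ShattersGrid {k : ℕ} {A : Type*} {Y : Fin k → Type*} (S : A → (∀ ℓ, Y ℓ) → Prop)
    (ι : Type*) : Prop :=
  ∃ a : ∀ ℓ, ι → Y ℓ, ∀ (u : Set (Fin k → ι)) (s : Finset (Fin k → ι)),
    ∃ x, ∀ η ∈ s, S x (fun ℓ => a ℓ (η ℓ)) ↔ η ∈ u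

theorem ShattersGrid.of_injective {k : ℕ} {A : Type*} {Y : Fin k → Type*}
    {S : A → (∀ ℓ, Y ℓ) → Prop} {ι ι' : Type*} (h : ShattersGrid S ι') (f : ι → ι')
    (hf : Function.Injective f) : ShattersGrid S ι := by
  classical
  obtain ⟨a, ha⟩ := h
  refine ⟨fun ℓ i => a ℓ (f i), fun u s => ?_⟩
  obtain ⟨x, hx⟩ := ha ((fun η => f ∘ η) '' u) (s.image fun η => f ∘ η)
  refine ⟨x, fun η hη => ?_⟩
  exact (hx (f ∘ η) (Finset.mem_image_of_mem _ hη)).trans (hf.comp_left.mem_set_image)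

/-- If a relation with a pair of object variables shatters infinite grids, then either it does so
after fixing the first object variable, or some projected pattern relation does so in the first
object variable. -/
theorem ShattersGrid.fix_or_project {k : ℕ} {A B : Type*} {Y : Fin k → Type*}
    {S : A → B → (∀ ℓ, Y ℓ) → Prop}
    (hS : ShattersGrid (fun (x : A × B) y => S x.1 x.2 y) ℕ) :
    (∀ n : ℕ, ∃ x, ShattersGrid (S x) (Fin n)) ∨
      ∃ (n : ℕ) (P : Set (Fin k → Fin n)), ∀ d : ℕ,
        ShattersGrid (Y := fun ℓ => Fin n → Y ℓ)
          (fun x y => ∃ z, ∀ σ, S x z (fun ℓ => y ℓ (σ ℓ)) ↔ σ ∈ P) (Fin d) := by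
  classical
  by_contra! hcon
  obtain ⟨⟨n, hn⟩, hP⟩ := hcon
  choose d hd using hP n
  obtain ⟨D, hD⟩ : ∃ D, ∀ P, d P ≤ D := (Set.finite_range d).bddAbove.imp fun D h P => h ⟨P, rfl⟩
  obtain ⟨r, hr⟩ := exists_dense_shattered (Set (Fin k → Fin n))
  obtain ⟨N, hN, hbox⟩ := exists_box_of_dense D k r
  set X := Fintype.piFinset fun ℓ => Finset.range (N ℓ) with hX
  have hXne : X.Nonempty :=
    ⟨0, Fintype.mem_piFinset.2 fun ℓ => Finset.mem_range.2 (hN ℓ)⟩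
  obtain ⟨a, ha⟩ := hS.of_injective (Encodable.encode : ℕ × Fin n → ℕ)
    Encodable.encode_injective
  let blk : (Fin k → ℕ) → (Fin k → Fin n) → Fin k → ℕ × Fin n :=
    fun h σ ℓ => (h ℓ, σ ℓ)
  let G : A → (Fin k → ℕ) → Set (Set (Fin k → Fin n)) := fun x h =>
    {P | ∃ z, ∀ σ, S x z (fun ℓ => a ℓ (blk h σ ℓ)) ↔ σ ∈ P}
  have hproper : ∀ x h, G x h ≠ Set.univ := by
    intro x h huniv
    refine hn x ⟨fun ℓ j => a ℓ (h ℓ, j), fun u s => ?_⟩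
    obtain ⟨z, hz⟩ := (Set.eq_univ_iff_forall.1 huniv u :)
    exact ⟨z, fun η _ => hz η⟩
  have hcover : ∀ R : (Fin k → ℕ) → Set (Fin k → Fin n), ∃ x, ∀ h ∈ X, R h ∈ G x h := by
    intro R
    obtain ⟨x, hx⟩ := ha {η | ∃ h σ, η = blk h σ ∧ σ ∈ R h}
      ((X ×ˢ Finset.univ).image fun z => blk z.1 z.2)
    refine ⟨x.1, fun h hh => ⟨x.2, fun σ => ?_⟩⟩
    refine (hx _ (Finset.mem_image.2 ⟨(h, σ), by simpa using hh, rfl⟩)).trans ?_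
    refine ⟨?_, fun hσ => ⟨h, σ, rfl, hσ⟩⟩
    rintro ⟨h', σ', heq, hσ'⟩
    have h1 : h = h' := funext fun ℓ => congrArg Prod.fst (congrFun heq ℓ)
    have h2 : σ = σ' := funext fun ℓ => congrArg Prod.snd (congrFun heq ℓ)
    rwa [h1, h2]
  obtain ⟨P, T, hTX, hT, hTsh⟩ := hr X hXne G hproper hcover
  obtain ⟨e, he, heT⟩ := hbox T hTX hT
  refine hd P (ShattersGrid.of_injective ?_ (Fin.castLE (hD P)) (Fin.castLE_injective _))
  refine ⟨fun ℓ i j => a ℓ (e ℓ i, j), fun u s => ?_⟩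
  obtain ⟨x, hx⟩ := hTsh (T.filter fun h => ∃ η ∈ u, h = fun ℓ => e ℓ (η ℓ))
    (Finset.filter_subset _ _)
  refine ⟨x, fun η _ => ?_⟩
  refine (hx _ (heT η)).trans ?_
  rw [Finset.mem_filter]
  refine ⟨?_, fun hη => ⟨heT η, η, hη, rfl⟩⟩
  rintro ⟨-, η', hη', heq⟩
  have : η = η' := funext fun ℓ => he ℓ (congrFun heq ℓ)
  rwa [this]

open FirstOrder.Language in
/-- Satisfaction of a finite part of a family of formulas by an assignment with finitely many
prescribed values is definable in the value of one variable. -/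
theorem exists_paramFormula_extends [Nonempty M] {V : Type u} {I : Type*} (Γ : I → L.Formula V)
    (s : Finset I) (g : Finset (V × M)) (x : V) :
    ∃ f : ParamFormula L M 1, f.paramsIn (Prod.snd '' (g : Set (V × M))) ∧
      ∀ c, f.Realize (fun _ => c) ↔
        ∃ v : V → M, (∀ i ∈ s, (Γ i).Realize v) ∧ (∀ z ∈ g, v z.1 = z.2) ∧ v x = c := by
  classical
  let Φ : L.Formula V := Formula.iInf fun i : s => Γ i
  let W : Finset V := Φ.freeVarFinset ∪ insert x (g.image Prod.fst)
  have hxW : x ∈ W := by simp [W]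
  have hgW : ∀ z ∈ g, z.1 ∈ W := fun z hz =>
    Finset.mem_union_right _ (Finset.mem_insert_of_mem (Finset.mem_image_of_mem _ hz))
  let e := g.equivFin
  let core : L.Formula ((Fin 1 ⊕ Fin g.card) ⊕ W) :=
    BoundedFormula.restrictFreeVar Φ fun y => Sum.inr ⟨y, Finset.mem_union_left _ y.2⟩
  let eqs : L.Formula ((Fin 1 ⊕ Fin g.card) ⊕ W) := Formula.iInf fun j : Fin g.card =>
    Term.equal (Term.var (Sum.inr ⟨(e.symm j).1.1, hgW _ (e.symm j).2⟩))
      (Term.var (Sum.inl (Sum.inr j)))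
  let eqx : L.Formula ((Fin 1 ⊕ Fin g.card) ⊕ W) :=
    Term.equal (Term.var (Sum.inr ⟨x, hxW⟩)) (Term.var (Sum.inl (Sum.inl 0)))
  refine ⟨⟨g.card, Formula.iExs W (core ⊓ (eqs ⊓ eqx)), fun j => (e.symm j).1.2⟩,
    fun j => ⟨(e.symm j).1, (e.symm j).2, rfl⟩, fun c => ?_⟩
  have hcore : ∀ (v : V → M) (w : (Fin 1 ⊕ Fin g.card) → M),
      core.Realize (Sum.elim w fun y : W => v y) ↔ ∀ i ∈ s, (Γ i).Realize v := by
    intro v w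
    have h1 : core.Realize (Sum.elim w fun y : W => v y) ↔ Φ.Realize v :=
      BoundedFormula.realize_restrictFreeVar v fun y => rfl
    rw [h1]
    simp [Φ]
  have heqs : ∀ v : V → M, eqs.Realize (Sum.elim
      (Sum.elim (fun _ => c) fun j => (e.symm j).1.2) fun y : W => v y) ↔
        ∀ z ∈ g, v z.1 = z.2 := by
    intro v
    simp only [eqs, Formula.realize_iInf, Formula.realize_equal, Term.realize_var, Sum.elim_inl,
      Sum.elim_inr]
    exact ⟨fun h z hz => by simpa using h (e ⟨z, hz⟩), fun h j => h _ (e.symm j).2⟩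
  have key : ∀ v : V → M, (core ⊓ (eqs ⊓ eqx)).Realize (Sum.elim
      (Sum.elim (fun _ => c) fun j => (e.symm j).1.2) fun y : W => v y) ↔
        (∀ i ∈ s, (Γ i).Realize v) ∧ (∀ z ∈ g, v z.1 = z.2) ∧ v x = c := by
    intro v
    rw [Formula.realize_inf, Formula.realize_inf, hcore, heqs]
    simp [eqx, Formula.realize_equal]
  simp only [ParamFormula.Realize, Formula.realize_iExs, ← key]
  refine ⟨?_, fun ⟨v, hv⟩ => ⟨_, hv⟩⟩
  rintro ⟨w, hw⟩
  refine ⟨fun y => if h : y ∈ W then w ⟨y, h⟩ else Classical.arbitrary M, ?_⟩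
  simpa using hw

open FirstOrder.Language in
/-- In a `κ`-saturated structure, a finitely satisfiable family of formulas in fewer than `κ`
variables is satisfiable. -/
theorem Saturated.exists_realize {κ : Cardinal.{u}} (hsat : Saturated L M κ) {V : Type u}
    (hV : #V < κ) {I : Type*} (Γ : I → L.Formula V)
    (hΓ : ∀ s : Finset I, ∃ v : V → M, ∀ i ∈ s, (Γ i).Realize v) :
    ∃ v : V → M, ∀ i, (Γ i).Realize v := by
  classical
  let Good : Set (Set (V × M)) := {g | ∀ (s : Finset I) (g₀ : Finset (V × M)), ↑g₀ ⊆ g →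
    ∃ v : V → M, (∀ i ∈ s, (Γ i).Realize v) ∧ ∀ z ∈ g₀, v z.1 = z.2}
  have hfin : Order.IsOfFiniteCharacter Good := by
    refine fun g => ⟨fun hg y hy _ s g₀ hg₀ => hg s g₀ (hg₀.trans hy), fun hg s g₀ hg₀ => ?_⟩
    exact hg g₀ hg₀ g₀.finite_toSet s g₀ subset_rfl
  have hempty : ∅ ∈ Good := by
    intro s g₀ hg₀
    obtain ⟨v, hv⟩ := hΓ s
    exact ⟨v, hv, fun z hz => (hg₀ hz).elim⟩
  obtain ⟨g, -, hg⟩ := hfin.exists_maximal hempty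
  have hgood : ∀ (s : Finset I) (g₀ : Finset (V × M)), ↑g₀ ⊆ g →
    ∃ v : V → M, (∀ i ∈ s, (Γ i).Realize v) ∧ ∀ z ∈ g₀, v z.1 = z.2 := hg.prop
  have htotal : ∀ x, ∃ c, (x, c) ∈ g := by
    intro x
    have : Nonempty M := ⟨(hgood ∅ ∅ (by simp)).choose x⟩
    have hcard : #(Prod.snd '' g : Set M) < κ := by
      refine (mk_image_le.trans (mk_le_of_injective (f := fun z : g => z.1.1) ?_)).trans_lt hV
      rintro ⟨⟨y, c⟩, hz⟩ ⟨⟨y', c'⟩, hz'⟩ (rfl : y = y')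
      obtain ⟨v, -, hv⟩ := hgood ∅ {(y, c), (y, c')} (by
        simp [Set.insert_subset_iff, hz, hz'])
      have h1 : v y = c := hv (y, c) (by simp)
      have h2 : v y = c' := hv (y, c') (by simp)
      simp [← h1, ← h2]
    let p : Set (ParamFormula L M 1) := {f | f.paramsIn (Prod.snd '' g) ∧
      ∃ (s : Finset I) (g₀ : Finset (V × M)), ↑g₀ ⊆ g ∧ ∀ v : V → M,
        (∀ i ∈ s, (Γ i).Realize v) → (∀ z ∈ g₀, v z.1 = z.2) → f.Realize fun _ => v x}
    obtain ⟨c, hc⟩ := hsat _ hcard p (fun f hf => hf.1) fun t ht htfin => by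
      choose! σ γ hγ hσ using fun f (hf : f ∈ p) => hf.2
      obtain ⟨v, hv, hv'⟩ := hgood (htfin.toFinset.biUnion σ) (htfin.toFinset.biUnion γ) (by
        simp only [Finset.coe_biUnion, Set.iUnion_subset_iff]
        exact fun f hf => hγ f (ht (by simpa using hf)))
      refine ⟨v x, fun f hf => hσ f (ht hf) v (fun i hi => hv i ?_) fun z hz => hv' z ?_⟩
      · exact Finset.mem_biUnion.2 ⟨f, by simpa using hf, hi⟩
      · exact Finset.mem_biUnion.2 ⟨f, by simpa using hf, hz⟩
    refine ⟨c, hg.le_of_ge (y := insert (x, c) g) ?_ (Set.subset_insert _ _)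
      (Set.mem_insert _ _)⟩
    intro s g₀ hg₀
    have hg₁ : ((g₀.erase (x, c) : Finset (V × M)) : Set (V × M)) ⊆ g := by
      intro z hz
      rw [Finset.mem_coe, Finset.mem_erase] at hz
      exact (hg₀ hz.2).resolve_left hz.1
    obtain ⟨f, hfp, hf⟩ := exists_paramFormula_extends Γ s (g₀.erase (x, c)) x
    obtain ⟨v, hv, hv', hvx⟩ := (hf c).1 (hc f ⟨fun i => Set.image_mono hg₁ (hfp i),
      s, _, hg₁, fun v hv hv' => (hf _).2 ⟨v, hv, hv', rfl⟩⟩)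
    refine ⟨v, hv, fun z hz => ?_⟩
    by_cases hzx : z = (x, c)
    · rw [hzx, hvx]
    · exact hv' z (Finset.mem_erase.2 ⟨hzx, hz⟩)
  choose v hv using htotal
  refine ⟨v, fun i => ?_⟩
  obtain ⟨v', hi, hv'⟩ := hgood {i} ((Γ i).freeVarFinset.image fun x => (x, v x)) (by
    intro z hz
    obtain ⟨x, -, rfl⟩ := Finset.mem_image.1 hz
    exact hv x)
  have h1 : ∀ y : (Γ i).freeVarFinset, v y = v' y := fun y =>
    (hv' (y, v y) (Finset.mem_image_of_mem _ y.2)).symm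
  exact (BoundedFormula.realize_restrictFreeVar (f := fun y => (y : V)) v fun y => rfl).1
    ((BoundedFormula.realize_restrictFreeVar v' h1).2 (hi i (by simp)))

/-- The relation between object tuples and arrays of parameter tuples defined by a formula. -/
def formulaRel {k nx : ℕ} {ny : Fin k → ℕ}
    (φ : L.Formula (Fin nx ⊕ ((ℓ : Fin k) × Fin (ny ℓ)))) (x : Fin nx → M)
    (y : ∀ ℓ, Fin (ny ℓ) → M) : Prop :=
  φ.Realize (Sum.elim x fun p => y p.1 p.2)

open FirstOrder.Language in
/-- The formula asserting that the truth values of the formulas `χ i` follow the pattern `P`. -/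
noncomputable def patternFormula {α σ : Type*} [Finite σ] (χ : σ → L.Formula α) (P : Set σ) :
    L.Formula α :=
  open Classical in Formula.iInf fun i => if i ∈ P then χ i else ∼(χ i)

open FirstOrder.Language in
theorem realize_patternFormula {α σ : Type*} [Finite σ] (χ : σ → L.Formula α) (P : Set σ)
    (v : α → M) : (patternFormula χ P).Realize v ↔ ∀ i, (χ i).Realize v ↔ i ∈ P := by
  rw [patternFormula, Formula.realize_iInf]
  refine forall_congr' fun i => ?_
  split_ifs with h <;> simp [h]

open FirstOrder.Language in
/-- In a saturated structure, a formula shattering all finite grids is `k`-independent. -/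
theorem FormulaKIndep.of_shattersGrid {κ : Cardinal.{u}} (hκ : ℵ₀ < κ) (hsat : Saturated L M κ)
    {k nx : ℕ} {ny : Fin k → ℕ} (φ : L.Formula (Fin nx ⊕ ((ℓ : Fin k) × Fin (ny ℓ))))
    (h : ∀ d : ℕ, ShattersGrid (formulaRel (M := M) φ) (Fin d)) :
    FormulaKIndep M κ k nx ny φ := by
  classical
  intro ι hι
  let V : Type u := ι × ((ℓ : Fin k) × Fin (ny ℓ))
  have hV : #V < κ := by
    rw [mk_prod, lift_id'.{0, u}]
    exact mul_lt_of_lt hκ.le (by simpa using hι) ((lift_lt_aleph0.2 mk_lt_aleph0).trans hκ)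
  let Γ : Set (Fin k → ι) × Finset (Fin k → ι) → L.Formula V := fun us =>
    Formula.iExs (Fin nx) (patternFormula (fun η : us.2 => φ.relabel
      (Sum.elim Sum.inr fun p => Sum.inl (η.1 p.1, p))) {η | η.1 ∈ us.1})
  have hΓ : ∀ us (v : V → M), (Γ us).Realize v ↔ ∃ x : Fin nx → M, ∀ η ∈ us.2,
      (φ.Realize (Sum.elim x fun p => v (η p.1, p)) ↔ η ∈ us.1) := by
    intro us v
    simp only [Γ, Formula.realize_iExs, realize_patternFormula, Formula.realize_relabel]
    refine exists_congr fun x => ?_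
    rw [Subtype.forall]
    refine forall₂_congr fun η hη => iff_congr (iff_of_eq (congrArg _ ?_)) Iff.rfl
    funext z
    rcases z with z | z <;> rfl
  obtain ⟨v, hv⟩ := hsat.exists_realize hV Γ fun t => by
    let J : Finset ι := t.biUnion fun us => us.2.biUnion fun η => Finset.univ.image η
    let g : ι → Fin (J.card + 1) := fun i =>
      if h : i ∈ J then (J.equivFin ⟨i, h⟩).castSucc else Fin.last _
    have hg : ∀ i ∈ J, ∀ j ∈ J, g i = g j → i = j := by
      intro i hi j hj hij
      simpa [g, hi, hj] using hij
    obtain ⟨a, ha⟩ := h (J.card + 1)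
    refine ⟨fun z => a z.2.1 (g z.1) z.2.2, fun us hus => (hΓ _ _).2 ?_⟩
    obtain ⟨x, hx⟩ := ha {η' | ∃ η ∈ us.2, η ∈ us.1 ∧ η' = g ∘ η} (us.2.image fun η => g ∘ η)
    refine ⟨x, fun η hη => (hx _ (Finset.mem_image_of_mem _ hη)).trans ?_⟩
    refine ⟨?_, fun hu => ⟨η, hη, hu, rfl⟩⟩
    rintro ⟨η', hη', hu, heq⟩
    have hJ : ∀ ζ ∈ us.2, ∀ ℓ, ζ ℓ ∈ J := fun ζ hζ ℓ =>
      Finset.mem_biUnion.2 ⟨us, hus, Finset.mem_biUnion.2 ⟨ζ, hζ, by simp⟩⟩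
    have : η = η' := funext fun ℓ => hg _ (hJ η hη ℓ) _ (hJ η' hη' ℓ) (congrFun heq ℓ)
    rwa [this]
  exact ⟨fun ℓ i j => v (i, ⟨ℓ, j⟩), fun u s => (hΓ (u, s) v).1 (hv (u, s))⟩

open FirstOrder.Language in
/-- From a `k`-independent formula in `m + 1` object variables one obtains a `k`-independent
formula in `m` object variables or in a single one. -/
theorem FormulaKIndep.exists_of_succ {κ : Cardinal.{u}} (hκ : ℵ₀ < κ) (hsat : Saturated L M κ)
    {k m : ℕ} (hk : 1 ≤ k) {ny : Fin k → ℕ}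
    {φ : L.Formula (Fin (m + 1) ⊕ ((ℓ : Fin k) × Fin (ny ℓ)))}
    (hφ : FormulaKIndep M κ k (m + 1) ny φ) :
    (∃ (ny' : Fin k → ℕ) (ψ : L.Formula (Fin m ⊕ ((ℓ : Fin k) × Fin (ny' ℓ)))),
      FormulaKIndep M κ k m ny' ψ) ∨
    ∃ (ny' : Fin k → ℕ) (ψ : L.Formula (Fin 1 ⊕ ((ℓ : Fin k) × Fin (ny' ℓ)))),
      FormulaKIndep M κ k 1 ny' ψ := by
  have hgrid : ShattersGrid (fun (x : M × (Fin m → M)) y =>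
      formulaRel φ (Fin.cons x.1 x.2 : Fin (m + 1) → M) y) ℕ := by
    obtain ⟨a, ha⟩ := ShattersGrid.of_injective (S := formulaRel (M := M) φ)
      (hφ (ULift ℕ) (by simpa using hκ)) (ULift.up : ℕ → ULift.{u} ℕ) ULift.up_injective
    refine ⟨a, fun u s => ?_⟩
    obtain ⟨x, hx⟩ := ha u s
    exact ⟨(x 0, Fin.tail x), by simpa only [Fin.cons_self_tail] using hx⟩
  rcases hgrid.fix_or_project
    (S := fun x z y => formulaRel φ (Fin.cons x z : Fin (m + 1) → M) y) with h | ⟨n, P, h⟩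
  · refine Or.inl ⟨fun ℓ => ny ℓ + 1, φ.relabel (Sum.elim
      (Fin.cons (Sum.inr ⟨⟨0, hk⟩, Fin.last _⟩) Sum.inl)
      fun p => Sum.inr ⟨p.1, p.2.castSucc⟩), .of_shattersGrid hκ hsat _ fun d => ?_⟩
    obtain ⟨x, a, ha⟩ := h d
    refine ⟨fun ℓ i => Fin.snoc (a ℓ i) x, fun u s => ?_⟩
    obtain ⟨z, hz⟩ := ha u s
    refine ⟨z, fun η hη => Iff.trans ?_ (hz η hη)⟩
    simp only [formulaRel, Formula.realize_relabel]
    refine iff_of_eq (congrArg _ (funext fun w => ?_))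
    rcases w with w | w
    · refine Fin.cases ?_ (fun i => ?_) w <;> simp
    · simp
  · refine Or.inr ⟨fun ℓ => n * ny ℓ, Formula.iExs (Fin m) (patternFormula
      (fun σ : Fin k → Fin n => φ.relabel (Sum.elim
        (Fin.cons (Sum.inl (Sum.inl 0)) Sum.inr)
        fun p => Sum.inl (Sum.inr ⟨p.1, finProdFinEquiv (σ p.1, p.2)⟩))) P),
      .of_shattersGrid hκ hsat _ fun d => ?_⟩
    obtain ⟨a, ha⟩ := h d
    refine ⟨fun ℓ i j => a ℓ i (finProdFinEquiv.symm j).1 (finProdFinEquiv.symm j).2,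
      fun u s => ?_⟩
    obtain ⟨x, hx⟩ := ha u s
    refine ⟨fun _ => x, fun η hη => Iff.trans ?_ (hx η hη)⟩
    simp only [formulaRel, Formula.realize_iExs, realize_patternFormula, Formula.realize_relabel]
    refine exists_congr fun z => forall_congr' fun σ =>
      iff_congr (iff_of_eq (congrArg _ (funext fun w => ?_))) Iff.rfl
    rcases w with w | w
    · refine Fin.cases ?_ (fun i => ?_) w <;> simp
    · simp only [Function.comp_apply, Sum.elim_inl, Sum.elim_inr, Equiv.symm_apply_apply]

/-- A `k`-independent formula in a nonempty tuple of object variables yields one in a single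
object variable. -/
theorem FormulaKIndep.exists_one {κ : Cardinal.{u}} (hκ : ℵ₀ < κ) (hsat : Saturated L M κ)
    {k m : ℕ} (hk : 1 ≤ k) (hm : 1 ≤ m) {ny : Fin k → ℕ}
    {φ : L.Formula (Fin m ⊕ ((ℓ : Fin k) × Fin (ny ℓ)))} (hφ : FormulaKIndep M κ k m ny φ) :
    ∃ (ny' : Fin k → ℕ) (ψ : L.Formula (Fin 1 ⊕ ((ℓ : Fin k) × Fin (ny' ℓ)))),
      FormulaKIndep M κ k 1 ny' ψ := by
  induction m, hm using Nat.le_induction generalizing ny with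
  | base => exact ⟨ny, φ, hφ⟩
  | succ m _ ih =>
    rcases hφ.exists_of_succ hκ hsat hk with ⟨ny', ψ, hψ⟩ | h
    · exact ih hψ
    · exact h

open FirstOrder.Language in
/-- Adding dummy object variables preserves `k`-independence. -/
theorem FormulaKIndep.relabel {κ : Cardinal.{u}} {k nx nx' : ℕ} {ny : Fin k → ℕ}
    {φ : L.Formula (Fin nx ⊕ ((ℓ : Fin k) × Fin (ny ℓ)))} (hφ : FormulaKIndep M κ k nx ny φ)
    (f : Fin nx → Fin nx') (hf : Function.Injective f) (hnx : 0 < nx) :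
    FormulaKIndep M κ k nx' ny (φ.relabel (Sum.map f id)) := by
  intro ι hι
  obtain ⟨a, ha⟩ := hφ ι hι
  refine ⟨a, fun u s => ?_⟩
  obtain ⟨x, hx⟩ := ha u s
  refine ⟨Function.extend f x fun _ => x ⟨0, hnx⟩, fun η hη => ?_⟩
  rw [Formula.realize_relabel, Sum.elim_comp_map, Function.extend_comp hf]
  exact hx η hη

/-- Claim 2.6(1),(2) of [Sh:886]: for `k ≥ 1`, there is a `k`-independent formula
`φ(x, ȳ_0, …, ȳ_{k-1})` with a single object variable iff there is one with some nonempty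
finite tuple `x̄_m` of object variables, iff there is one for every `m ≥ 1`. -/
theorem claim_dt56
    {L : FirstOrder.Language.{u, u}} {M : Type u} [L.Structure M]
    (κbar : Cardinal.{u}) (hκinacc : κbar.IsInaccessible) (hκT : theoryCard L < κbar)
    (hκsat : Saturated L M κbar)
    (k : ℕ) (hk : 1 ≤ k) :
    ((∃ (ny : Fin k → ℕ) (φ : L.Formula (Fin 1 ⊕ ((ℓ : Fin k) × Fin (ny ℓ)))),
        FormulaKIndep M κbar k 1 ny φ) ↔
      (∃ m : ℕ, 1 ≤ m ∧ ∃ (ny : Fin k → ℕ)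
          (φ : L.Formula (Fin m ⊕ ((ℓ : Fin k) × Fin (ny ℓ)))),
        FormulaKIndep M κbar k m ny φ)) ∧
    ((∃ m : ℕ, 1 ≤ m ∧ ∃ (ny : Fin k → ℕ)
          (φ : L.Formula (Fin m ⊕ ((ℓ : Fin k) × Fin (ny ℓ)))),
        FormulaKIndep M κbar k m ny φ) ↔
      (∀ m : ℕ, 1 ≤ m → ∃ (ny : Fin k → ℕ)
          (φ : L.Formula (Fin m ⊕ ((ℓ : Fin k) × Fin (ny ℓ)))),
        FormulaKIndep M κbar k m ny φ)) := by
  have up : (∃ (ny : Fin k → ℕ) (φ : L.Formula (Fin 1 ⊕ ((ℓ : Fin k) × Fin (ny ℓ)))),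
      FormulaKIndep M κbar k 1 ny φ) → ∀ m : ℕ, 1 ≤ m → ∃ (ny : Fin k → ℕ)
        (φ : L.Formula (Fin m ⊕ ((ℓ : Fin k) × Fin (ny ℓ)))), FormulaKIndep M κbar k m ny φ := by
    rintro ⟨ny, φ, hφ⟩ m hm
    exact ⟨ny, _, hφ.relabel (Fin.castLE hm) (Fin.castLE_injective hm) one_pos⟩
  have down : (∃ m : ℕ, 1 ≤ m ∧ ∃ (ny : Fin k → ℕ)
      (φ : L.Formula (Fin m ⊕ ((ℓ : Fin k) × Fin (ny ℓ)))), FormulaKIndep M κbar k m ny φ) →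
        ∃ (ny : Fin k → ℕ) (φ : L.Formula (Fin 1 ⊕ ((ℓ : Fin k) × Fin (ny ℓ)))),
          FormulaKIndep M κbar k 1 ny φ := by
    rintro ⟨m, hm, ny, φ, hφ⟩
    exact hφ.exists_one hκinacc.aleph0_lt hκsat hk hm
  exact ⟨⟨fun h => ⟨1, le_rfl, h⟩, down⟩, fun h => up (down h), fun h => ⟨1, le_rfl, h 1 le_rfl⟩⟩

end Paper886
end
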